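/- Let p ≥ 5 be a prime, let k be a positive integer, and let F ∈ ℤ_(p)[Q,R] be isobaric of weight k and not involving P. Then for every integer m ≥ 1, the polynomial D^{mp²}F lies in (A^p, p)^{m+1}; in other words, v(D^{mp²}F) ≥ m + 1. -/

import Mathlib

open MvPolynomial Finset

noncomputable section

/-- `x` lies in `ℤ_(p) ⊆ ℚ`: `p` does not divide the reduced denominator of `x`. -/
def pInt (p : ℕ) (x : ℚ) : Prop := ¬ p ∣ x.den

/-- The polynomial ring `ℚ[P,Q,R]`, with `P = X 0`, `Q = X 1`, `R = X 2`. -/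
abbrev Poly3 : Type := MvPolynomial (Fin 3) ℚ

/-- `f` has all of its coefficients in `ℤ_(p)`. -/
def polyPInt (p : ℕ) (f : Poly3) : Prop := ∀ m : Fin 3 →₀ ℕ, pInt p (coeff m f)

/-- `f` is isobaric of weight `w`, where `P, Q, R` have weights `2, 4, 6`. -/
def Isobaric (w : ℕ) (f : Poly3) : Prop :=
  ∀ m ∈ f.support, 2 * m 0 + 4 * m 1 + 6 * m 2 = w

/-- `f` does not involve the variable `P`. -/
def NoP (f : Poly3) : Prop := ∀ m ∈ f.support, m 0 = 0

/-- The Ramanujan derivation `D` on `ℚ[P,Q,R]`, the unique derivation with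
`DP = (P²-Q)/12`, `DQ = (PQ-R)/3`, `DR = (PR-Q²)/2`. -/
def Dop (f : Poly3) : Poly3 :=
  C (1/12 : ℚ) * (X 0 ^ 2 - X 1) * pderiv 0 f
    + C (1/3 : ℚ) * (X 0 * X 1 - X 2) * pderiv 1 f
    + C (1/2 : ℚ) * (X 0 * X 2 - X 1 ^ 2) * pderiv 2 f

/-- The sum of the `j`-th powers of the divisors of `n`, as a rational number. -/
def sigmaQ (j n : ℕ) : ℚ := ∑ d ∈ n.divisors, (d : ℚ) ^ j

/-- The q-expansion of `E₂`. -/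
def E2s : PowerSeries ℚ := PowerSeries.mk fun n => if n = 0 then 1 else -24 * sigmaQ 1 n

/-- The q-expansion of `E₄`. -/
def E4s : PowerSeries ℚ := PowerSeries.mk fun n => if n = 0 then 1 else 240 * sigmaQ 3 n

/-- The q-expansion of `E₆`. -/
def E6s : PowerSeries ℚ := PowerSeries.mk fun n => if n = 0 then 1 else -504 * sigmaQ 5 n

/-- The q-expansion of the normalized Eisenstein series `E_{p-1}`. -/
def EAs (p : ℕ) : PowerSeries ℚ :=
  PowerSeries.mk fun n => if n = 0 then 1 else
    -(2 * ((p : ℚ) - 1) / bernoulli (p - 1)) * sigmaQ (p - 2) n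

/-- The q-expansion of the normalized Eisenstein series `E_{p+1}`. -/
def EBs (p : ℕ) : PowerSeries ℚ :=
  PowerSeries.mk fun n => if n = 0 then 1 else
    -(2 * ((p : ℚ) + 1) / bernoulli (p + 1)) * sigmaQ p n

/-- `Φ : ℚ[P,Q,R] → ℚ[[q]]`, the algebra map sending `P, Q, R` to `E₂, E₄, E₆`. -/
def Phi : Poly3 →ₐ[ℚ] PowerSeries ℚ := aeval ![E2s, E4s, E6s]

/-- The theta operator attached to the polynomials `A` and `B`:
`θf = ((BQ-AR)/3)·∂f/∂Q + ((BR-AQ²)/2)·∂f/∂R`. -/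
def thetaOp (A B f : Poly3) : Poly3 :=
  C (1/3 : ℚ) * (B * X 1 - A * X 2) * pderiv 1 f
    + C (1/2 : ℚ) * (B * X 2 - A * X 1 ^ 2) * pderiv 2 f

/-- `f` lies in the `n`-th power of the ideal `(A^p, p)` of `ℤ_(p)[P,Q,R]`. -/
def InIdealPow (p : ℕ) (A : Poly3) (n : ℕ) (f : Poly3) : Prop :=
  ∃ G : ℕ → Poly3, (∀ i, polyPInt p (G i)) ∧
    f = ∑ i ∈ Finset.range (n + 1), (p : Poly3) ^ (n - i) * A ^ (p * i) * G i

section P1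

section Analytic

open UpperHalfPlane hiding I
open scoped Manifold MatrixGroups ModularForm Topology
open Filter

/-- `f` is given on the upper half plane by the convergent `q`-series `a`. -/
def HasQ (f : ℍ → ℂ) (a : PowerSeries ℂ) : Prop :=
  ∀ τ : ℍ, HasSum (fun m : ℕ => PowerSeries.coeff m a • Function.Periodic.qParam (1 : ℝ) τ ^ m) (f τ)

lemma HasQ.add {f g : ℍ → ℂ} {a b : PowerSeries ℂ} (hf : HasQ f a) (hg : HasQ g b) :
    HasQ (fun z => f z + g z) (a + b) := by
  intro τ
  simpa [add_mul] using (hf τ).add (hg τ)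

lemma HasQ.sub {f g : ℍ → ℂ} {a b : PowerSeries ℂ} (hf : HasQ f a) (hg : HasQ g b) :
    HasQ (fun z => f z - g z) (a - b) := by
  intro τ
  simpa [sub_mul] using (hf τ).sub (hg τ)

lemma HasQ.smul {f : ℍ → ℂ} {a : PowerSeries ℂ} (hf : HasQ f a) (c : ℂ) :
    HasQ (fun z => c * f z) (c • a) := by
  intro τ
  simpa [mul_assoc] using (hf τ).mul_left c

lemma HasQ.mul {f g : ℍ → ℂ} {a b : PowerSeries ℂ} (hf : HasQ f a) (hg : HasQ g b) :
    HasQ (fun z => f z * g z) (a * b) := by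
  intro τ
  have h1 := (hf τ).summable.norm
  have h2 := (hg τ).summable.norm
  have h3 := (summable_norm_sum_mul_antidiagonal_of_summable_norm h1 h2).of_norm
  have h4 := tsum_mul_tsum_eq_tsum_sum_antidiagonal_of_summable_norm h1 h2
  rw [(hf τ).tsum_eq, (hg τ).tsum_eq] at h4
  change HasSum _ (f τ * g τ)
  rw [h4]
  refine h3.hasSum.congr_fun ?_ 
  intro n
  rw [PowerSeries.coeff_mul, smul_eq_mul, Finset.sum_mul]
  refine Finset.sum_congr rfl fun x hx => ?_
  rw [Finset.HasAntidiagonal.mem_antidiagonal] at hx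
  rw [← hx, pow_add]
  simp only [smul_eq_mul]
  ring

/-- The operator `q d/dq`. -/
def thetaC {K : Type*} [CommRing K] (a : PowerSeries K) : PowerSeries K :=
  PowerSeries.mk fun n => (n : K) * PowerSeries.coeff n a

lemma HasQ.deriv {f : ℍ → ℂ} {a : PowerSeries ℂ} (hf : HasQ f a) :
    HasQ (Derivative.normalizedDerivOfComplex f) (thetaC a) := by
  intro τ
  set U : Set ℂ := {w | τ.im / 2 < w.im} with hU
  have hUo : IsOpen U := isOpen_lt continuous_const Complex.continuous_im
  have hτ : (τ : ℂ) ∈ U := by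
    have := τ.im_pos
    change τ.im / 2 < τ.im
    linarith
  let σ : ℍ := ⟨⟨0, τ.im / 2⟩, by have := τ.im_pos; simpa using this⟩
  have hs := (hf σ).summable.norm
  let Fn : ℕ → ℂ → ℂ := fun n w => PowerSeries.coeff n a * Function.Periodic.qParam (1 : ℝ) w ^ n
  have hd : ∀ (n : ℕ) (w : ℂ), HasDerivAt (Fn n)
      (2 * Real.pi * Complex.I * ((n : ℂ) * PowerSeries.coeff n a * Function.Periodic.qParam (1 : ℝ) w ^ n)) w := by
    intro n w
    have : Fn n = fun w => PowerSeries.coeff n a * Complex.exp (n * (2 * Real.pi * Complex.I * w)) := by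
      funext w
      simp [Fn, Function.Periodic.qParam, Complex.exp_nat_mul]
    rw [this]
    have h1 : HasDerivAt (fun w : ℂ => (n : ℂ) * (2 * Real.pi * Complex.I * w)) ((n : ℂ) * (2 * Real.pi * Complex.I * 1)) w :=
      ((hasDerivAt_id w).const_mul _).const_mul _
    convert! (h1.cexp).const_mul (PowerSeries.coeff n a) using 1
    simp only [Function.Periodic.qParam, ← Complex.exp_nat_mul]
    simp
    ring
  have key := Complex.hasSum_deriv_of_summable_norm (F := Fn) (U := U) (z := τ) hs
    (fun n w _ => (hd n w).differentiableAt.differentiableWithinAt) hUo ?_ hτ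
  · have h2 : _root_.deriv (fun w : ℂ => ∑' i : ℕ, Fn i w) τ = _root_.deriv (f ∘ ofComplex) τ := by
      apply Filter.EventuallyEq.deriv_eq
      filter_upwards [isOpen_upperHalfPlaneSet.mem_nhds τ.im_pos] with w hw
      have := (hf ⟨w, hw⟩).tsum_eq
      simp only [Function.comp, ofComplex_apply_of_im_pos hw]
      rw [← this]
      rfl
    rw [h2] at key
    have h3 := key.mul_left (2 * Real.pi * Complex.I)⁻¹
    unfold Derivative.normalizedDerivOfComplex
    refine h3.congr_fun ?_
    intro n
    rw [(hd n τ).deriv]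
    have : (2 * Real.pi * Complex.I : ℂ) ≠ 0 := by simp [Real.pi_ne_zero]
    rw [inv_mul_cancel_left₀ this]
    simp [thetaC]
  · intro n w hw
    simp only [Fn, norm_mul, norm_pow, smul_eq_mul]
    gcongr
    rw [Function.Periodic.norm_qParam, Function.Periodic.norm_qParam]
    apply Real.exp_le_exp.2
    have : (σ : ℂ).im ≤ w.im := le_of_lt hw
    have hpi := Real.pi_pos
    simp only [div_one]
    nlinarith

lemma HasQ.vanish {f : ℍ → ℂ} {a : PowerSeries ℂ} (k : ℕ) (hk : k < 12) (hf : HasQ f a)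
    (hd : MDiff f) (hinv : ∀ γ : SL(2, ℤ), f ∣[(k : ℤ)] γ = f) (h0 : PowerSeries.coeff 0 a = 0) :
    a = 0 := by
  let F : ModularForm 𝒮ℒ (k : ℤ) :=
    { toFun := f
      slash_action_eq' := fun _ ⟨γ, hγ⟩ ↦ hγ ▸ hinv γ
      holo' := hd
      bdd_at_cusps' := by
        intro c hc
        rw [Subgroup.IsArithmetic.isCusp_iff_isCusp_SL2Z] at hc
        rw [OnePoint.isBoundedAt_iff_forall_SL2Z hc]
        intro γ _
        rw [hinv γ]
        exact isBoundedAtImInfty_of_hasSum_qExpansion one_pos hf }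
  have hF : ∀ m, PowerSeries.coeff m a = (qExpansion 1 F).coeff m := 
    ModularFormClass.qExpansion_coeff_unique (f := F) one_pos one_mem_strictPeriods_SL hf
  have : F = 0 := by
    apply ModularForm.sturm_bound_levelOne_nat
    have : k / 12 = 0 := by omega
    rw [this]
    have h1 : ((qExpansion 1 F).coeff 0) = 0 := by rw [← hF, h0]
    rw [Nat.cast_zero, pos_iff_ne_zero, PowerSeries.order_ne_zero_iff_constCoeff_eq_zero]
    simpa using h1
  ext m
  rw [hF, this, FunLike.coe_zero, qExpansion_zero]

end Analytic

end P1

section P2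

section Ramanujan
set_option linter.unusedSimpArgs false

open UpperHalfPlane hiding I
open scoped Manifold MatrixGroups ModularForm Topology
open Filter

/-- Base change of a power series from `ℚ` to `ℂ`. -/
def toC : PowerSeries ℚ →+* PowerSeries ℂ := PowerSeries.map (algebraMap ℚ ℂ)

lemma toC_injective : Function.Injective toC :=
  PowerSeries.map_injective _ (algebraMap ℚ ℂ).injective

lemma toC_theta (a : PowerSeries ℚ) : toC (thetaC a) = thetaC (toC a) := by
  ext n
  simp [toC, thetaC]

lemma sigmaQ_cast (j n : ℕ) : ((sigmaQ j n : ℚ) : ℂ) = (ArithmeticFunction.sigma j n : ℂ) := by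
  simp [sigmaQ, ArithmeticFunction.sigma_apply]

lemma hasQ_E2 : HasQ EisensteinSeries.E2 (toC E2s) := by
  intro τ
  have := EisensteinSeries.hasSum_qExpansion_E2 (z := τ)
  simp only [Function.Periodic.qParam, Complex.ofReal_one, div_one]
  refine this.congr_fun ?_
  intro n
  simp only [toC, E2s, PowerSeries.coeff_map, PowerSeries.coeff_mk]
  split_ifs with h
  · simp
  · simp [sigmaQ_cast]

lemma hasQ_E {k : ℕ} (hk : 3 ≤ k) (hk2 : Even k) (a : PowerSeries ℚ)
    (ha : ∀ n, PowerSeries.coeff n a = if n = 0 then 1 else -(2 * k / bernoulli k) * sigmaQ (k - 1) n) :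
    HasQ (ModularForm.E hk) (toC a) := by
  intro τ
  have := ModularForm.hasSum_qExpansion (f := ModularForm.E hk) one_pos one_mem_strictPeriods_SL τ
  refine this.congr_fun ?_
  intro n
  rw [EisensteinSeries.E_qExpansion_coeff hk hk2]
  simp only [toC, PowerSeries.coeff_map, ha]
  split_ifs with h
  · simp
  · simp [sigmaQ_cast]

lemma bern4 : bernoulli 4 = -1/30 := by
  decide +kernel

lemma bern6 : bernoulli 6 = 1/42 := by
  decide +kernel

lemma hasQ_E4 : HasQ (ModularForm.E (k := 4) (by norm_num)) (toC E4s) := by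
  apply hasQ_E _ (by decide)
  intro n
  simp only [E4s, PowerSeries.coeff_mk, bern4]
  norm_num

lemma hasQ_E6 : HasQ (ModularForm.E (k := 6) (by norm_num)) (toC E6s) := by
  apply hasQ_E _ (by decide)
  intro n
  simp only [E6s, PowerSeries.coeff_mk, bern6]
  norm_num

lemma coeff0_theta {K : Type*} [CommRing K] (a : PowerSeries K) : PowerSeries.coeff 0 (thetaC a) = 0 := by
  simp [thetaC]

lemma coeff0_E2 : PowerSeries.coeff 0 (toC E2s) = 1 := by simp [toC, E2s]
lemma coeff0_E4 : PowerSeries.coeff 0 (toC E4s) = 1 := by simp [toC, E4s]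
lemma coeff0_E6 : PowerSeries.coeff 0 (toC E6s) = 1 := by simp [toC, E6s]

lemma E_inv {k : ℕ} (hk : 3 ≤ k) (γ : SL(2, ℤ)) :
    (ModularForm.E hk : ℍ → ℂ) ∣[(k : ℤ)] γ = ModularForm.E hk := by
  exact (ModularForm.E hk).slash_action_eq' _ ⟨γ, rfl⟩

lemma E_mdiff {k : ℕ} (hk : 3 ≤ k) : MDiff (ModularForm.E hk : ℍ → ℂ) := (ModularForm.E hk).holo'

lemma ram4C : thetaC (toC E4s) - (1/3 : ℂ) • (toC E2s * toC E4s) + (1/3 : ℂ) • toC E6s = 0 := by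
  have hE4 := E_mdiff (k := 4) (by norm_num)
  have hE6 := E_mdiff (k := 6) (by norm_num)
  have hq := ((hasQ_E4.deriv.sub ((hasQ_E2.mul hasQ_E4).smul (1/3))).add (hasQ_E6.smul (1/3)))
  have hfe : (fun z => Derivative.normalizedDerivOfComplex (ModularForm.E (k := 4) (by norm_num)) z
      - (1/3) * (EisensteinSeries.E2 z * ModularForm.E (k := 4) (by norm_num) z)
      + (1/3) * ModularForm.E (k := 6) (by norm_num) z) =
      Derivative.serreDerivative 4 (ModularForm.E (k := 4) (by norm_num)) +
      (1/3 : ℂ) • (ModularForm.E (k := 6) (by norm_num) : ℍ → ℂ) := by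
    funext z
    simp [Derivative.serreDerivative]
    ring
  rw [hfe] at hq
  refine hq.vanish 6 (by norm_num) ?_ ?_ ?_
  · exact (Derivative.serreDerivative_mdifferentiable 4 hE4).add (hE6.const_smul _)
  · intro γ
    have h1 : Derivative.serreDerivative 4 (ModularForm.E (k := 4) (by norm_num)) ∣[(6:ℤ)] γ =
        Derivative.serreDerivative 4 (ModularForm.E (k := 4) (by norm_num)) := by
      have := Derivative.serreDerivative_slash_invariant (k := 4) hE4 (γ := γ) (E_inv _ γ)
      simpa only [Int.cast_ofNat, Int.reduceAdd] using this
    have h2 := E_inv (k := 6) (by norm_num) γ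
    rw [SlashAction.add_slash, ModularForm.SL_smul_slash]
    simp only [Nat.cast_ofNat] at h2 ⊢
    rw [h1, h2]
  · simp [coeff0_theta, coeff0_E2, coeff0_E4, coeff0_E6, PowerSeries.coeff_mul]
    simp [← PowerSeries.coeff_zero_eq_constantCoeff_apply, coeff0_theta, coeff0_E2, coeff0_E4, coeff0_E6]

lemma ram6C : thetaC (toC E6s) - (1/2 : ℂ) • (toC E2s * toC E6s) + (1/2 : ℂ) • (toC E4s * toC E4s) = 0 := by
  have hE4 := E_mdiff (k := 4) (by norm_num)
  have hE6 := E_mdiff (k := 6) (by norm_num)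
  have hq := ((hasQ_E6.deriv.sub ((hasQ_E2.mul hasQ_E6).smul (1/2))).add ((hasQ_E4.mul hasQ_E4).smul (1/2)))
  have hfe : (fun z => Derivative.normalizedDerivOfComplex (ModularForm.E (k := 6) (by norm_num)) z
      - (1/2) * (EisensteinSeries.E2 z * ModularForm.E (k := 6) (by norm_num) z)
      + (1/2) * (ModularForm.E (k := 4) (by norm_num) z * ModularForm.E (k := 4) (by norm_num) z)) =
      Derivative.serreDerivative 6 (ModularForm.E (k := 6) (by norm_num)) +
      (1/2 : ℂ) • ((ModularForm.E (k := 4) (by norm_num) : ℍ → ℂ) * (ModularForm.E (k := 4) (by norm_num) : ℍ → ℂ)) := by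
    funext z
    simp [Derivative.serreDerivative]
    ring
  rw [hfe] at hq
  refine hq.vanish 8 (by norm_num) ?_ ?_ ?_
  · exact (Derivative.serreDerivative_mdifferentiable 6 hE6).add ((hE4.mul hE4).const_smul _)
  · intro γ
    have h1 : Derivative.serreDerivative 6 (ModularForm.E (k := 6) (by norm_num)) ∣[(8:ℤ)] γ =
        Derivative.serreDerivative 6 (ModularForm.E (k := 6) (by norm_num)) := by
      have := Derivative.serreDerivative_slash_invariant (k := 6) hE6 (γ := γ) (E_inv _ γ)
      simpa only [Int.cast_ofNat, Int.reduceAdd] using this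
    have h2 := E_inv (k := 4) (by norm_num) γ
    have h3 := ModularForm.mul_slash_SL2 4 4 γ (ModularForm.E (k := 4) (by norm_num)) (ModularForm.E (k := 4) (by norm_num))
    simp only [Int.reduceAdd] at h3
    rw [SlashAction.add_slash, ModularForm.SL_smul_slash]
    simp only [Nat.cast_ofNat] at h2 ⊢
    rw [h1, h3, h2]
  · simp [coeff0_theta, coeff0_E2, coeff0_E4, coeff0_E6, PowerSeries.coeff_mul]
    simp [← PowerSeries.coeff_zero_eq_constantCoeff_apply, coeff0_theta, coeff0_E2, coeff0_E4, coeff0_E6]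

lemma D_u (γ : SL(2, ℤ)) (c : ℂ) (z : ℍ) :
    Derivative.normalizedDerivOfComplex (fun z : ℍ => c * ((γ 1 0 : ℤ) : ℂ) / denom γ z) z =
      - (2 * Real.pi * Complex.I)⁻¹ * c * ((γ 1 0 : ℤ) : ℂ) ^ 2 / denom γ z ^ 2 := by
  have h := (hasDerivAt_denom_zpow (γ : GL (Fin 2) ℝ) (-1) z).const_mul (c * ((γ 1 0 : ℤ) : ℂ))
  unfold Derivative.normalizedDerivOfComplex
  have hcomp : ((fun z : ℍ => c * ((γ 1 0 : ℤ) : ℂ) / denom γ z) ∘ ofComplex) =ᶠ[𝓝 ↑z]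
      fun w ↦ (c * ((γ 1 0 : ℤ) : ℂ)) * (denom γ w) ^ (-1 : ℤ) := by
    filter_upwards [isOpen_upperHalfPlaneSet.mem_nhds z.im_pos] with w hw
    simp [ofComplex_apply_of_im_pos hw, div_eq_mul_inv]
  rw [(h.congr_of_eventuallyEq hcomp).deriv]
  have hz := denom_ne_zero (γ : GL (Fin 2) ℝ) z
  have e : (-1 - 1 : ℤ) = -(2 : ℕ) := rfl
  rw [e, zpow_neg, zpow_natCast]
  simp
  field_simp

lemma ram2C : thetaC (toC E2s) - (1/12 : ℂ) • (toC E2s * toC E2s) + (1/12 : ℂ) • toC E4s = 0 := by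
  have hE4 := E_mdiff (k := 4) (by norm_num)
  have hE2 := E2_mdifferentiable
  have hq := ((hasQ_E2.deriv.sub ((hasQ_E2.mul hasQ_E2).smul (1/12))).add (hasQ_E4.smul (1/12)))
  have hfe : (fun z => Derivative.normalizedDerivOfComplex EisensteinSeries.E2 z
      - (1/12) * (EisensteinSeries.E2 z * EisensteinSeries.E2 z)
      + (1/12) * ModularForm.E (k := 4) (by norm_num) z) =
      (Derivative.serreDerivative 2 EisensteinSeries.E2 +
      (1/12 : ℂ) • (EisensteinSeries.E2 * EisensteinSeries.E2)) +
      (1/12 : ℂ) • (ModularForm.E (k := 4) (by norm_num) : ℍ → ℂ) := by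
    funext z
    simp
    ring
  rw [hfe] at hq
  refine hq.vanish 4 (by norm_num) ?_ ?_ ?_
  · exact ((Derivative.serreDerivative_mdifferentiable 2 hE2).add ((hE2.mul hE2).const_smul _)).add
      (hE4.const_smul _)
  · intro γ
    have h1 : Derivative.serreDerivative 2 EisensteinSeries.E2 ∣[(4:ℤ)] γ =
        Derivative.serreDerivative 2 (EisensteinSeries.E2 ∣[(2:ℤ)] γ) := by
      have := Derivative.serreDerivative_slash_equivariant (k := 2) hE2 (γ := γ)
      simpa only [Int.cast_ofNat, Int.reduceAdd] using this
    have h2 := E_inv (k := 4) (by norm_num) γ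
    have h3 := ModularForm.mul_slash_SL2 2 2 γ EisensteinSeries.E2 EisensteinSeries.E2
    simp only [Int.reduceAdd] at h3
    set u : ℍ → ℂ := fun z : ℍ => (-(6 * Complex.I / Real.pi)) * ((γ 1 0 : ℤ) : ℂ) / denom γ z with hu
    have hE : EisensteinSeries.E2 ∣[(2:ℤ)] γ = EisensteinSeries.E2 + u := by
      rw [EisensteinSeries.E2_slash_action]
      funext z
      have hpi : (Real.pi : ℂ) ≠ 0 := by simp [Real.pi_ne_zero]
      simp [EisensteinSeries.D2, riemannZeta_two, hu]
      field_simp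
      ring
    have hum : MDiff u := by
      have : u = (EisensteinSeries.E2 ∣[(2:ℤ)] γ) - EisensteinSeries.E2 := by rw [hE]; simp
      rw [this]
      exact MDifferentiable.sub (hE2.slash _ _) hE2
    rw [SlashAction.add_slash, SlashAction.add_slash, ModularForm.SL_smul_slash, ModularForm.SL_smul_slash]
    simp only [Nat.cast_ofNat] at h2 ⊢
    rw [h1, h3, h2, hE]
    congr 1
    funext z
    have hD := congrFun (Derivative.normalizedDerivOfComplex_add EisensteinSeries.E2 u hE2 hum) z
    have hDu := D_u γ (-(6 * Complex.I / Real.pi)) z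
    have hpi : (Real.pi : ℂ) ≠ 0 := by simp [Real.pi_ne_zero]
    have hz := denom_ne_zero (γ : GL (Fin 2) ℝ) z
    have hkey : Derivative.normalizedDerivOfComplex u z + (1/12) * u z ^ 2 = 0 := by
      rw [hDu]
      simp only [hu]
      field_simp
      rw [Complex.I_sq]
      ring
    simp only [Pi.add_apply, Pi.smul_apply, Pi.mul_apply, smul_eq_mul, Derivative.serreDerivative_apply] at hD ⊢
    rw [hD]
    linear_combination hkey
  · simp [coeff0_theta, coeff0_E2, coeff0_E4, coeff0_E6, PowerSeries.coeff_mul]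
    simp [← PowerSeries.coeff_zero_eq_constantCoeff_apply, coeff0_theta, coeff0_E2, coeff0_E4, coeff0_E6]

end Ramanujan

lemma toC_smul (c : ℚ) (a : PowerSeries ℚ) : toC (c • a) = (c : ℂ) • toC a := by
  ext n
  simp [toC]

lemma ram2 : thetaC E2s = (1/12 : ℚ) • (E2s ^ 2 - E4s) := by
  apply toC_injective
  rw [toC_theta, toC_smul, map_sub, map_pow]
  have h := ram2C
  rw [smul_sub, pow_two]
  push_cast
  linear_combination (exp := 1) h

lemma ram4 : thetaC E4s = (1/3 : ℚ) • (E2s * E4s - E6s) := by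
  apply toC_injective
  rw [toC_theta, toC_smul, map_sub, map_mul]
  have h := ram4C
  rw [smul_sub]
  push_cast
  linear_combination (exp := 1) h

lemma ram6 : thetaC E6s = (1/2 : ℚ) • (E2s * E6s - E4s ^ 2) := by
  apply toC_injective
  rw [toC_theta, toC_smul, map_sub, map_mul, map_pow]
  have h := ram6C
  rw [smul_sub, pow_two]
  push_cast
  linear_combination (exp := 1) h

lemma thetaC_eq {K : Type*} [CommRing K] (a : PowerSeries K) :
    thetaC a = PowerSeries.X * PowerSeries.derivative K a := by
  ext n
  cases n with
  | zero => simp [thetaC]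
  | succ n =>
    rw [PowerSeries.coeff_succ_X_mul, PowerSeries.coeff_derivative]
    simp [thetaC, mul_comm]

lemma thetaC_add {K : Type*} [CommRing K] (a b : PowerSeries K) :
    thetaC (a + b) = thetaC a + thetaC b := by
  simp [thetaC_eq, mul_add]

lemma thetaC_mul {K : Type*} [CommRing K] (a b : PowerSeries K) :
    thetaC (a * b) = thetaC a * b + a * thetaC b := by
  simp [thetaC_eq]
  ring

lemma Dop_add (f g : Poly3) : Dop (f + g) = Dop f + Dop g := by
  simp only [Dop, map_add]; ring

lemma Dop_mul (f g : Poly3) : Dop (f * g) = Dop f * g + f * Dop g := by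
  simp only [Dop, Derivation.leibniz, smul_eq_mul]; ring

lemma Phi_X0 : Phi (X 0) = E2s := by simp [Phi]
lemma Phi_X1 : Phi (X 1) = E4s := by simp [Phi]
lemma Phi_X2 : Phi (X 2) = E6s := by simp [Phi]
lemma Phi_C (c : ℚ) : Phi (C c) = PowerSeries.C c := by simp [Phi]

lemma Phi_Dop (f : Poly3) : Phi (Dop f) = thetaC (Phi f) := by
  induction f using MvPolynomial.induction_on with
  | C a => simp [Dop, Phi_C, thetaC_eq, PowerSeries.derivative_C]
  | add f g hf hg => rw [Dop_add, map_add, map_add, thetaC_add, hf, hg]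
  | mul_X f i hf =>
    rw [Dop_mul, map_add, map_mul, map_mul, map_mul, thetaC_mul, hf]
    congr 2
    fin_cases i
    · simp [Dop, Phi_X0, Phi_X1, Phi_C, ram2, PowerSeries.smul_eq_C_mul, pderiv_X]
    · simp [Dop, Phi_X0, Phi_X1, Phi_X2, Phi_C, ram4, PowerSeries.smul_eq_C_mul, pderiv_X]
    · simp [Dop, Phi_X0, Phi_X1, Phi_X2, Phi_C, ram6, PowerSeries.smul_eq_C_mul, pderiv_X]

end P2

section P4a

section Core
set_option linter.unusedSectionVars false
variable {S T : Type*} [CommRing S] [CommRing T]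

/-- The algebraic structure needed for the main argument. -/
structure CoreHyp (p : ℕ) (D E N th : Derivation ℤ S S) (A ε : S) (Ψ : S →+* T) (θ : T → T) :
    Prop where
  hp : p.Prime
  hp5 : 5 ≤ p
  hpp : Prime (p : S)
  ED : ∀ f, E (D f) = D (E f) + 2 * D f
  ND : ∀ f, N (D f) = D (N f) + E f
  NA : N A = 0
  EA : E A = ((p : S) - 1) * A
  Aε : D A = ((p : S) - 1) * ε
  th_eq : ∀ f, th f = A * D f - ε * E f
  ΨD : ∀ f, Ψ (D f) = θ (Ψ f)
  θ0 : θ 0 = 0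
  θ1 : θ 1 = 0
  θp : ∀ t, θ^[p] t = θ t
  ΨA : Ψ A = 1
  Ψp : (p : T) = 0
  inj : ∀ (k : ℕ) (f : S), N f = 0 → E f = (k : S) * f → Ψ f = 0 → (p : S) ∣ f

/-- Elements of weight `k` killed by `N`. -/
def Mk (E N : Derivation ℤ S S) (k : ℕ) (f : S) : Prop := N f = 0 ∧ E f = (k : S) * f

lemma iter_leibniz (D : Derivation ℤ S S) (n : ℕ) (a b : S) :
    D^[n] (a * b) = ∑ ij ∈ antidiagonal n, (n.choose ij.1 : S) * (D^[ij.1] a * D^[ij.2] b) := by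
  induction n with
  | zero => simp
  | succ n ih =>
    rw [Function.iterate_succ_apply', ih, map_sum,
      Finset.sum_antidiagonal_choose_succ_mul (fun i j => D^[i] a * D^[j] b), ← Finset.sum_add_distrib]
    refine Finset.sum_congr rfl fun ij hij => ?_
    simp only [Derivation.leibniz, smul_eq_mul, Function.iterate_succ_apply', Derivation.map_natCast]
    rw [Nat.choose_symm_of_eq_add (Finset.HasAntidiagonal.mem_antidiagonal.1 hij).symm]
    ring

lemma iter_add (D : Derivation ℤ S S) (n : ℕ) (a b : S) : D^[n] (a + b) = D^[n] a + D^[n] b := by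
  induction n with
  | zero => rfl
  | succ n ih => simp only [Function.iterate_succ_apply', ih, map_add]

lemma iter_zero (D : Derivation ℤ S S) (n : ℕ) : D^[n] (0 : S) = 0 := by
  induction n with
  | zero => rfl
  | succ n ih => simp only [Function.iterate_succ_apply', ih, map_zero]

lemma iter_const (D : Derivation ℤ S S) (n : ℕ) {c : S} (hc : D c = 0) (a : S) :
    D^[n] (c * a) = c * D^[n] a := by
  induction n with
  | zero => rfl
  | succ n ih => simp only [Function.iterate_succ_apply', ih, Derivation.leibniz, smul_eq_mul, hc]; ring

lemma iter_dvd (D : Derivation ℤ S S) (n : ℕ) {c : S} (hc : D c = 0) {a : S} (h : c ∣ a) :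
    c ∣ D^[n] a := by
  obtain ⟨b, rfl⟩ := h
  rw [iter_const D n hc]
  exact dvd_mul_right _ _

lemma iter_sub (D : Derivation ℤ S S) (n : ℕ) (a b : S) : D^[n] (a - b) = D^[n] a - D^[n] b := by
  induction n with
  | zero => rfl
  | succ n ih => simp only [Function.iterate_succ_apply', ih, map_sub]

lemma D_natpow (D : Derivation ℤ S S) (p n : ℕ) : D ((p : S) ^ n) = 0 := by
  rw [← Nat.cast_pow, Derivation.map_natCast]

lemma Mk_mul {k l : ℕ} {f g : S} (hf : Mk E N k f) (hg : Mk E N l g) : Mk E N (k + l) (f * g) := by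
  constructor
  · simp [hf.1, hg.1]
  · simp [hf.2, hg.2]; ring

lemma Mk_sub {k : ℕ} {f g : S} (hf : Mk E N k f) (hg : Mk E N k g) : Mk E N k (f - g) := by
  constructor
  · simp [hf.1, hg.1]
  · simp [hf.2, hg.2]; ring

lemma Mk_pow {k : ℕ} {f : S} (hf : Mk E N k f) (n : ℕ) : Mk E N (n * k) (f ^ n) := by
  induction n with
  | zero => constructor <;> simp
  | succ n ih =>
    rw [pow_succ]
    convert! Mk_mul ih hf using 1
    ring

variable [IsDomain S] [Nontrivial T] {p : ℕ} {D E N th : Derivation ℤ S S} {A ε : S} {Ψ : S →+* T}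
  {θ : T → T}

namespace CoreHyp
variable (h : CoreHyp p D E N th A ε Ψ θ)
include h

lemma p_ne : (p : S) ≠ 0 := h.hpp.ne_zero

lemma p1_ne : (p : S) - 1 ≠ 0 := by
  intro h0
  apply h.hpp.not_isUnit
  rw [sub_eq_zero.1 h0]
  exact isUnit_one

lemma A_ndvd : ¬ (p : S) ∣ A := by
  rintro ⟨c, hc⟩
  have := congrArg Ψ hc
  rw [h.ΨA, map_mul, map_natCast, h.Ψp, zero_mul] at this
  exact one_ne_zero this

lemma Ψε : Ψ ε = 0 := by
  have := congrArg Ψ h.Aε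
  rw [h.ΨD, h.ΨA, h.θ1, map_mul, map_sub, map_natCast, h.Ψp, map_one] at this
  simpa using this

lemma Ψth (f : S) : Ψ (th f) = θ (Ψ f) := by
  rw [h.th_eq, map_sub, map_mul, map_mul, h.Ψε, h.ΨA, h.ΨD]; ring

lemma Nε : N ε = A := by
  apply mul_left_cancel₀ h.p1_ne
  have := h.ND A
  rw [h.Aε, h.NA, h.EA, map_zero, Derivation.leibniz] at this
  simpa using this

lemma Eε : E ε = ((p : S) + 1) * ε := by
  apply mul_left_cancel₀ h.p1_ne
  have := h.ED A
  rw [h.Aε, h.EA, Derivation.leibniz, Derivation.leibniz, h.Aε] at this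
  simp at this
  linear_combination this

lemma thA : th A = 0 := by
  rw [h.th_eq, h.EA, h.Aε]; ring

lemma thA_pow (n : ℕ) : th (A ^ n) = 0 := by
  rw [Derivation.leibniz_pow, h.thA]; simp

lemma Mk_th {k : ℕ} {f : S} (hf : Mk E N k f) : Mk E N (k + (p + 1)) (th f) := by
  obtain ⟨h1, h2⟩ := hf
  constructor
  · rw [h.th_eq, map_sub, Derivation.leibniz, Derivation.leibniz, h.Nε, h.NA, h2, h.ND, h1, h2,
      Derivation.leibniz, h1]
    simp
    ring
  · have e : D (E f) = k * D f := by rw [h2, Derivation.leibniz]; simp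
    have e2 : E (E f) = k * (k * f) := by rw [h2, Derivation.leibniz]; simp [h2]
    rw [h.th_eq, map_sub, Derivation.leibniz, Derivation.leibniz, h.Eε, h.EA, h.ED, e, e2, h2]
    simp
    ring

lemma Mk_iter {k : ℕ} {f : S} (hf : Mk E N k f) (n : ℕ) :
    Mk E N (k + n * (p + 1)) (th^[n] f) := by
  induction n with
  | zero => simpa using hf
  | succ n ih =>
    rw [Function.iterate_succ_apply']
    have := h.Mk_th ih
    convert! this using 1
    ring

lemma Mk_A : Mk E N (p - 1) A := by
  refine ⟨h.NA, ?_⟩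
  rw [h.EA, Nat.cast_sub h.hp.one_le]; simp

lemma Mk_div {k : ℕ} {f : S} (hf : Mk E N k f) (h0 : Ψ f = 0) : ∃ g, Mk E N k g ∧ f = p * g := by
  obtain ⟨g, rfl⟩ := h.inj k f hf.1 hf.2 h0
  refine ⟨g, ⟨?_, ?_⟩, rfl⟩
  · have := hf.1
    rw [Derivation.leibniz] at this
    simpa [h.p_ne] using this
  · apply mul_left_cancel₀ h.p_ne
    have := hf.2
    rw [Derivation.leibniz] at this
    simp at this
    rw [this]; ring

lemma exists_H : ∃ H, Mk E N (2 * p + 2) H ∧ th ε = p * H - ε ^ 2 := by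
  have hW : Mk E N (2 * p + 2) (th ε + ε ^ 2) := by
    have e1 : N (D ε) = D A + (p + 1) * ε := by rw [h.ND, h.Nε, h.Eε]
    have e2 : E (D ε) = (p + 3) * D ε := by
      rw [h.ED, h.Eε, Derivation.leibniz]
      simp
      ring
    constructor
    · rw [h.th_eq, h.Eε]
      simp only [map_add, map_sub, Derivation.leibniz, Derivation.leibniz_pow, h.Nε, e1, h.NA, h.Aε]
      simp
      ring
    · rw [h.th_eq, h.Eε]
      simp only [map_add, map_sub, Derivation.leibniz, Derivation.leibniz_pow, h.Eε, e2, h.EA]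
      simp
      ring
  obtain ⟨H, h1, h2⟩ := h.Mk_div hW (by rw [map_add, map_pow, h.Ψth, h.Ψε, h.θ0]; simp)
  exact ⟨H, h1, by linear_combination h2⟩

lemma exists_U {k : ℕ} {f : S} (hf : Mk E N k f) :
    ∃ U, Mk E N (k + p * (p + 1)) U ∧ th^[p] f = A ^ (p + 1) * th f + p * U := by
  have h1 := h.Mk_iter hf p
  have h2 := Mk_mul (Mk_pow h.Mk_A (p + 1)) (h.Mk_th hf)
  have e : (p + 1) * (p - 1) + (k + (p + 1)) = k + p * (p + 1) := by
    obtain ⟨q, rfl⟩ : ∃ q, p = q + 1 := ⟨p - 1, by have := h.hp.one_le; omega⟩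
    simp; ring
  rw [e] at h2
  have key : ∀ n, Ψ (th^[n] f) = θ^[n] (Ψ f) := by
    intro n
    induction n with
    | zero => rfl
    | succ n ih => rw [Function.iterate_succ_apply', Function.iterate_succ_apply', h.Ψth, ih]
  obtain ⟨U, h3, h4⟩ := h.Mk_div (Mk_sub h1 h2) (by
    rw [map_sub, key, h.θp, map_mul, map_pow, h.ΨA, h.Ψth]; simp)
  exact ⟨U, h3, by linear_combination h4⟩

end CoreHyp
end Core

end P4a

section P4b

section Core2
set_option linter.unusedSectionVars false
variable {S T : Type*} [CommRing S] [CommRing T]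

/-- coefficients `c(n,j)` -/
def cc (k n j : ℕ) : ℕ := n.choose j * (n + k).descFactorial j

lemma cc_mul (k n j : ℕ) : (j + 1) * cc k n (j + 1) = cc k n j * ((n - j) * (n + k - j)) := by
  unfold cc
  rw [Nat.descFactorial_succ]
  have := Nat.choose_succ_right_eq n j
  calc _ = (n.choose (j+1) * (j+1)) * ((n + k - j) * (n + k).descFactorial j) := by ring
    _ = _ := by rw [this]; ring

lemma cc_succ (k n j : ℕ) (hj : j ≤ n) :
    cc k (n + 1) (j + 1) = cc k n (j + 1) + (k + 1 + 2 * n - j) * cc k n j := by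
  have h1 : (n + 1 + k).descFactorial (j + 1) = (n + 1 + k) * (n + k).descFactorial j := by
    rw [show n + 1 + k = (n + k) + 1 by ring, Nat.succ_descFactorial_succ]
  have h2 : (n + k).descFactorial (j + 1) = (n + k - j) * (n + k).descFactorial j :=
    Nat.descFactorial_succ _ _
  have h3 := Nat.choose_succ_right_eq n j
  unfold cc
  rw [h1, h2, Nat.choose_succ_succ]
  obtain ⟨d, rfl⟩ := Nat.exists_eq_add_of_le hj
  have e1 : j + d + k - j = d + k := by omega
  have e2 : k + 1 + 2 * (j + d) - j = k + 1 + j + 2 * d := by omega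
  have e3 : j + d - j = d := by omega
  rw [e1, e2]
  rw [e3] at h3
  generalize (j + d + k).descFactorial j = X
  generalize (j + d).choose (j+1) = Y at *
  generalize (j + d).choose j = Z at *
  zify at *
  linear_combination (X : ℤ) * h3

lemma cc_zero (k n : ℕ) : cc k n 0 = 1 := by simp [cc]
lemma cc_big (k n j : ℕ) (h : n < j) : cc k n j = 0 := by simp [cc, Nat.choose_eq_zero_of_lt h]

lemma cc_dvd (k n j : ℕ) (hj : 0 < j) : n ∣ cc k n j := by
  obtain ⟨i, rfl⟩ : ∃ i, j = i + 1 := ⟨j - 1, by omega⟩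
  cases n with
  | zero => simp [cc]
  | succ n =>
    unfold cc
    rw [Nat.descFactorial_eq_factorial_mul_choose, ← mul_assoc, mul_comm (Nat.choose _ _),
      ← Nat.descFactorial_eq_factorial_mul_choose, Nat.succ_descFactorial_succ, mul_assoc]
    exact dvd_mul_right _ _

/-- the sequence `G_r` -/
def GG (th : Derivation ℤ S S) (k : ℕ) (W F : S) : ℕ → S
  | 0 => F
  | 1 => th F
  | (r + 2) => th (GG th k W F (r + 1)) + ((r + 1) * (r + 1 + k) : ℕ) * W * GG th k W F r

lemma th_GG (th : Derivation ℤ S S) (k : ℕ) (W F : S) (r : ℕ) :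
    th (GG th k W F r) = GG th k W F (r + 1) - ((r * (r + k) : ℕ) : S) * W * GG th k W F (r - 1) := by
  cases r with
  | zero => simp [GG]
  | succ r => simp [GG]

lemma X_sum (th : Derivation ℤ S S) (k : ℕ) (W F ε : S) (hε : th ε = W - ε ^ 2)
    (x : ℕ → S) (x0 : x 0 = F)
    (xs : ∀ n, x (n + 1) = th (x n) + ((k + 1 + 2 * n : ℕ) : S) * ε * x n) (n : ℕ) :
    x n = ∑ j ∈ range (n + 1), (cc k n j : S) * (ε ^ j * GG th k W F (n - j)) := by
  induction n with
  | zero => simp [x0, cc_zero, GG]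
  | succ n ih =>
    set G := GG th k W F with hG
    have key : th (x n) = ∑ j ∈ range (n + 1), (cc k n j : S) * (ε ^ j * G (n + 1 - j))
        - ∑ j ∈ range (n + 1), (j : S) * (cc k n j : S) * (ε ^ (j + 1) * G (n - j)) := by
      have e1 : ∀ j ∈ range (n + 1), th ((cc k n j : S) * (ε ^ j * G (n - j))) =
          (cc k n j : S) * (ε ^ j * G (n + 1 - j))
          - (j : S) * (cc k n j : S) * (ε ^ (j + 1) * G (n - j))
          + ((j : S) * (cc k n j : S) * (W * ε ^ (j - 1) * G (n - j))
            - ((j + 1 : ℕ) : S) * (cc k n (j + 1) : S) * (W * ε ^ j * G (n - (j + 1)))) := by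
        intro j hj
        have hj' : j ≤ n := by simpa [Nat.lt_succ_iff] using hj
        have := cc_mul k n j
        have e : (((j + 1 : ℕ) : S) * (cc k n (j + 1) : S)) = (cc k n j : S) * (((n - j) * ((n - j) + k) : ℕ) : S) := by
          rw [← Nat.cast_mul, this, show n + k - j = n - j + k by omega, Nat.cast_mul]
        rw [e]
        simp only [Derivation.leibniz, Derivation.leibniz_pow, smul_eq_mul, hε, Derivation.map_natCast]
        rw [hG, th_GG, ← hG, show n - j + 1 = n + 1 - j by omega, show n - (j + 1) = n - j - 1 by omega]
        simp only [nsmul_eq_mul]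
        cases j with
        | zero => simp; ring
        | succ i =>
          simp only [Nat.add_sub_cancel]
          ring
      rw [ih, map_sum, Finset.sum_congr rfl e1, Finset.sum_add_distrib, Finset.sum_sub_distrib]
      have e2 := Finset.sum_range_sub' (fun j : ℕ => (j : S) * (cc k n j : S) * (W * ε ^ (j - 1) * G (n - j))) (n + 1)
      simp only [Nat.add_sub_cancel] at e2
      rw [e2, cc_big k n (n+1) (by omega)]
      simp
    rw [xs, key, ih, Finset.sum_range_succ' _ (n + 1)]
    have e3 : ∑ j ∈ range (n + 1), (cc k n j : S) * (ε ^ j * G (n + 1 - j)) =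
        ∑ j ∈ range (n + 1), (cc k n (j+1) : S) * (ε ^ (j+1) * G (n - j)) + G (n + 1) := by
      have : ∑ j ∈ range (n + 1 + 1), (cc k n j : S) * (ε ^ j * G (n + 1 - j)) =
        ∑ j ∈ range (n + 1), (cc k n j : S) * (ε ^ j * G (n + 1 - j)) := by
        rw [Finset.sum_range_succ, cc_big k n (n+1) (by omega)]; simp
      rw [← this, Finset.sum_range_succ']
      simp [cc_zero]
    rw [e3, Finset.mul_sum]
    have e4 : ∀ j ∈ range (n + 1), (cc k (n + 1) (j + 1) : S) * (ε ^ (j + 1) * G (n + 1 - (j + 1))) =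
        (cc k n (j+1) : S) * (ε ^ (j+1) * G (n - j)) - (j : S) * (cc k n j : S) * (ε ^ (j + 1) * G (n - j))
        + ((k + 1 + 2 * n : ℕ) : S) * ε * ((cc k n j : S) * (ε ^ j * G (n - j))) := by
      intro j hj
      have hj' : j ≤ n := by simpa [Nat.lt_succ_iff] using hj
      rw [cc_succ k n j hj', Nat.cast_add, Nat.cast_mul, Nat.cast_sub (by omega), Nat.add_sub_add_right]
      ring
    rw [Finset.sum_congr rfl e4, Finset.sum_add_distrib, Finset.sum_sub_distrib]
    simp [cc_zero]
    ring

/-- coefficients of the first-order correction -/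
def aa (k n i : ℕ) : ℕ := 2 * n.choose (i + 3) + (k + 1) * n.choose (i + 2)

/-- the first-order correction -/
def TT (th : Derivation ℤ S S) (k : ℕ) (H F : S) (m : ℕ) : S :=
  ∑ i ∈ range (m + 1), (aa k (m + 2) i : S) * (th^[i] H * th^[m - i] F)

lemma aa_succ (k n i : ℕ) : aa k (n + 1) (i + 1) = aa k n i + aa k n (i + 1) := by
  simp only [aa, Nat.choose_succ_succ]
  ring

lemma aa_zero (k m : ℕ) : aa k (m + 3) 0 = aa k (m + 2) 0 + (m + 2) * (m + 2 + k) := by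
  have h := Nat.choose_succ_right_eq (m+2) 1
  simp only [Nat.choose_one_right] at h
  have e1 : (m+3).choose 3 = (m+2).choose 2 + (m+2).choose 3 := Nat.choose_succ_succ _ _
  have e2 : (m+3).choose 2 = (m+2).choose 1 + (m+2).choose 2 := Nat.choose_succ_succ _ _
  simp only [aa, zero_add, e1, e2, Nat.choose_one_right]
  have : m + 2 - 1 = m + 1 := by omega
  rw [this] at h
  zify at *
  linear_combination h

lemma TT_succ (th : Derivation ℤ S S) (k : ℕ) (H F : S) (m : ℕ) :
    TT th k H F (m + 1) = th (TT th k H F m) + (((m + 2) * (m + 2 + k) : ℕ) : S) * (H * th^[m + 1] F) := by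
  unfold TT
  rw [map_sum]
  have e1 : ∀ i ∈ range (m + 1), th ((aa k (m + 2) i : S) * (th^[i] H * th^[m - i] F)) =
      (aa k (m + 2) i : S) * (th^[i + 1] H * th^[m - i] F) +
      (aa k (m + 2) i : S) * (th^[i] H * th^[m + 1 - i] F) := by
    intro i hi
    have hi' : i ≤ m := by simpa [Nat.lt_succ_iff] using hi
    rw [show m + 1 - i = (m - i) + 1 by omega]
    simp only [Derivation.leibniz, smul_eq_mul, Derivation.map_natCast, Function.iterate_succ_apply']
    ring
  rw [Finset.sum_congr rfl e1, Finset.sum_add_distrib]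
  have e2 : ∑ i ∈ range (m + 1), (aa k (m + 2) i : S) * (th^[i] H * th^[m + 1 - i] F) =
      ∑ i ∈ range (m + 1), (aa k (m + 2) (i + 1) : S) * (th^[i + 1] H * th^[m - i] F)
        + (aa k (m + 2) 0 : S) * (H * th^[m + 1] F) := by
    have : ∑ i ∈ range (m + 1 + 1), (aa k (m + 2) i : S) * (th^[i] H * th^[m + 1 - i] F) =
      ∑ i ∈ range (m + 1), (aa k (m + 2) i : S) * (th^[i] H * th^[m + 1 - i] F) := by
      rw [Finset.sum_range_succ]
      have : aa k (m + 2) (m + 1) = 0 := by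
        simp [aa, Nat.choose_eq_zero_of_lt]
      rw [this]; simp
    rw [← this, Finset.sum_range_succ']
    simp [Nat.add_sub_add_right]
  rw [e2, Finset.sum_range_succ', ← add_assoc, ← Finset.sum_add_distrib]
  rw [show m + 1 + 2 = m + 2 + 1 by ring]
  rw [Finset.sum_congr rfl (g := fun i => (aa k (m + 2) i : S) * (th^[i + 1] H * th^[m - i] F) +
     (aa k (m + 2) (i + 1) : S) * (th^[i + 1] H * th^[m - i] F))
     (fun i hi => by rw [aa_succ, Nat.cast_add, Nat.add_sub_add_right]; ring)]
  rw [show m + 2 + 1 = m + 3 by ring, aa_zero]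
  simp
  ring

lemma th_dvd (th : Derivation ℤ S S) {c : S} (hc : th c = 0) {a : S} (h : c ∣ a) : c ∣ th a :=
  iter_dvd th 1 hc h

lemma GG_mod1 (th : Derivation ℤ S S) (k p : ℕ) (H F : S) (n : ℕ) :
    (p : S) ∣ GG th k (p * H) F n - th^[n] F := by
  induction n using Nat.twoStepInduction with
  | zero => simp [GG]
  | one => simp [GG]
  | more n h1 h2 =>
    have := th_dvd th (Derivation.map_natCast th p) h2
    rw [map_sub, ← Function.iterate_succ_apply' th] at this
    rw [GG, add_sub_right_comm]
    refine dvd_add this ?_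
    exact ⟨((n + 1) * (n + 1 + k) : ℕ) * H * GG th k (p * H) F n, by ring⟩

lemma GG_mod2 (th : Derivation ℤ S S) (k p : ℕ) (H F : S) (m : ℕ) :
    (p : S) ^ 2 ∣ GG th k (p * H) F (m + 2) - (th^[m + 2] F + p * TT th k H F m) := by
  induction m with
  | zero =>
    simp [GG, TT, aa]
    ring_nf
    simp
  | succ m ih =>
    have h1 := th_dvd th (D_natpow th p 2) ih
    obtain ⟨c, hc⟩ := GG_mod1 th k p H F (m + 1)
    rw [map_sub, map_add, ← Function.iterate_succ_apply' th, Derivation.leibniz] at h1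
    simp only [smul_eq_mul, Derivation.map_natCast] at h1
    rw [GG, TT_succ]
    have := dvd_add h1 (dvd_mul_right ((p : S) ^ 2) (((m + 2) * (m + 2 + k) : ℕ) * H * c))
    convert! this using 1
    push_cast
    linear_combination ((m : S) + 2) * (m + 2 + k) * p * H * hc

lemma aa_dvd {p : ℕ} (hp : p.Prime) (k i : ℕ) (hi : i + 3 < p ^ 2) : p ∣ aa k (p ^ 2) i := by
  have h1 : p ∣ (p ^ 2).choose (i + 3) := hp.dvd_choose_pow (by omega) (by omega)
  have h2 : p ∣ (p ^ 2).choose (i + 2) := hp.dvd_choose_pow (by omega) (by omega)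
  exact dvd_add (h1.mul_left _) (h2.mul_left _)

variable [IsDomain S] [Nontrivial T] {p : ℕ} {D E N th : Derivation ℤ S S} {A ε : S} {Ψ : S →+* T}
  {θ : T → T}

namespace CoreHyp
variable (h : CoreHyp p D E N th A ε Ψ θ)
include h

lemma th_steps {k : ℕ} {f : S} (hf : Mk E N k f) (r j : ℕ) :
    (p : S) ∣ th^[j * (p - 1) + (r + 1)] f - A ^ (j * (p + 1)) * th^[r + 1] f := by
  induction j with
  | zero => simp
  | succ j ih =>
    have hp := h.hp.one_le
    obtain ⟨U, -, hU⟩ := h.exists_U hf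
    have e : th^[(j + 1) * (p - 1) + (r + 1)] f = A ^ (p + 1) * th^[j * (p - 1) + (r + 1)] f
        + p * th^[j * (p - 1) + r] U := by
      rw [show (j + 1) * (p - 1) + (r + 1) = (j * (p - 1) + r) + p by
        obtain ⟨q, rfl⟩ : ∃ q, p = q + 1 := ⟨p - 1, by omega⟩
        simp; ring]
      rw [Function.iterate_add_apply, hU, iter_add, iter_const _ _ (h.thA_pow _),
        iter_const _ _ (Derivation.map_natCast _ _), ← add_assoc, Function.iterate_succ_apply]
    rw [e, show (j + 1) * (p + 1) = j * (p + 1) + (p + 1) by ring, pow_add]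
    have := dvd_add (ih.mul_left (A ^ (p + 1))) (dvd_mul_right (p : S) (th^[j * (p - 1) + r] U))
    convert! this using 1
    ring

lemma th_psq {k : ℕ} {f : S} (hf : Mk E N k f) :
    ∃ U : S, (p : S) ^ 2 ∣ th^[p ^ 2] f - A ^ (p ^ 2 + p) * (A ^ (p + 1) * th f + p * U) := by
  obtain ⟨U, hUM, hU⟩ := h.exists_U hf
  obtain ⟨V, -, hV⟩ := h.exists_U hUM
  refine ⟨U, ?_⟩
  have key : ∀ n : ℕ, (p : S) ^ 2 ∣ th^[p * n] f - ((A ^ (p + 1)) ^ n * th^[n] f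
      + n * (A ^ (p + 1)) ^ (n - 1) * p * th^[n - 1] U) := by
    intro n
    induction n with
    | zero => simp
    | succ n ih =>
      have h1 := iter_dvd th p (D_natpow th p 2) ih
      have hq : ∀ n, th ((A ^ (p + 1)) ^ n) = 0 := fun n => by rw [← pow_mul, h.thA_pow]
      have hc : th ((n : S) * (A ^ (p + 1)) ^ (n - 1) * p) = 0 := by
        simp [Derivation.leibniz, hq]
      rw [iter_sub, iter_add, iter_const _ _ (hq n), iter_const _ _ hc, ← Function.iterate_add_apply,
        ← Function.iterate_add_apply, ← Function.iterate_add_apply, add_comm p n, add_comm p (n - 1),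
        Function.iterate_add_apply th n p, Function.iterate_add_apply th (n - 1) p, hU, hV,
        iter_add, iter_add, iter_const th n (h.thA_pow _), iter_const th (n - 1) (h.thA_pow _),
        iter_const th n (Derivation.map_natCast _ _), iter_const th (n - 1) (Derivation.map_natCast _ _),
        ← Function.iterate_succ_apply th, ← Function.iterate_succ_apply th] at h1
      rw [show p * (n + 1) = p + p * n by ring]
      have h2 := dvd_add h1 (dvd_mul_right ((p : S) ^ 2) (n * (A ^ (p + 1)) ^ (n - 1) * th^[n - 1] V))
      convert! h2 using 1
      cases n with
      | zero => simp
      | succ n =>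
        simp
        ring
  have h3 := key p
  have hp := h.hp.one_le
  rw [← sq] at h3
  have h4 := dvd_add h3 (dvd_mul_right ((p : S) ^ 2) ((A ^ (p + 1)) ^ (p - 1) * th^[p - 1] U))
  convert! h4 using 1
  rw [hU]
  ring

lemma X_rec {k : ℕ} {F : S} (hF : Mk E N (k + 1) F) (n : ℕ) :
    A ^ (n + 1) * D^[n + 1] F = th (A ^ n * D^[n] F) + ((k + 1 + 2 * n : ℕ) : S) * ε * (A ^ n * D^[n] F) := by
  have hE : ∀ n, E (D^[n] F) = ((k + 1 + 2 * n : ℕ) : S) * D^[n] F := by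
    intro n
    induction n with
    | zero => simpa using hF.2
    | succ n ih =>
      rw [Function.iterate_succ_apply', h.ED, ih, Derivation.leibniz, Derivation.map_natCast]
      push_cast
      simp only [smul_eq_mul]
      ring
  rw [Derivation.leibniz, h.thA_pow, h.th_eq, hE, Function.iterate_succ_apply']
  simp
  ring

theorem base {k : ℕ} {F : S} (hF : Mk E N (k + 1) F) :
    ∃ a b c : S, D^[p ^ 2] F = A ^ (2 * p) * a + p * A ^ p * b + (p : S) ^ 2 * c := by
  obtain ⟨H, hH, hε⟩ := h.exists_H
  have hp5 := h.hp5
  have hpsq : 25 ≤ p ^ 2 := by nlinarith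
  have h1 := X_sum th k (p * H) F ε hε (fun n => A ^ n * D^[n] F) (by simp) (h.X_rec hF) (p ^ 2)
  -- modulo p^2 only the term j = 0 survives
  have h2 : (p : S) ^ 2 ∣ A ^ p ^ 2 * D^[p ^ 2] F - GG th k (p * H) F (p ^ 2) := by
    rw [h1, Finset.sum_range_succ']
    simp only [cc_zero, pow_zero, Nat.sub_zero, Nat.cast_one, one_mul, add_sub_cancel_right]
    apply Finset.dvd_sum
    intro j _
    apply Dvd.dvd.mul_right
    have := cc_dvd k (p ^ 2) (j + 1) (by omega)
    have := Nat.cast_dvd_cast (α := S) this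
    simpa using this
  obtain ⟨m, hm⟩ : ∃ m, p ^ 2 = m + 3 := ⟨p ^ 2 - 3, by omega⟩
  have h3 := GG_mod2 th k p H F (m + 1)
  obtain ⟨U, h4⟩ := h.th_psq hF
  have hT : (p : S) ∣ TT th k H F (m + 1) -
      (2 * (th^[m] H * th F) + (k + 1) * (th^[m + 1] H * F)) := by
    unfold TT
    rw [Finset.sum_range_succ, Finset.sum_range_succ]
    have e1 : aa k (m + 1 + 2) (m + 1) = k + 1 := by
      simp [aa]
    have e2 : aa k (m + 1 + 2) m = 2 + (k + 1) * p ^ 2 := by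
      rw [hm]
      simp [aa, show m + 1 + 2 = m + 2 + 1 by ring]
    rw [e1, e2]
    have e3 : (p : S) ∣ ∑ i ∈ range m, (aa k (m + 1 + 2) i : S) * (th^[i] H * th^[m + 1 - i] F) := by
      apply Finset.dvd_sum
      intro i hi
      apply Dvd.dvd.mul_right
      have hi' : i < m := by simpa using hi
      have := aa_dvd h.hp k i (by omega)
      rw [hm] at this
      exact Nat.cast_dvd_cast this
    have := dvd_add e3 (dvd_mul_right (p : S) ((k + 1) * p * (th^[m] H * th F)))
    convert! this using 1
    simp
    ring
  have eA : p * (p + 1) = p ^ 2 + p := by ring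
  have h5 : (p : S) ∣ th^[m] H - A ^ (p ^ 2 + p) * th^[p - 3] H := by
    have := h.th_steps hH (p - 4) p
    rw [show p * (p - 1) + (p - 4 + 1) = m by
      obtain ⟨q, rfl⟩ : ∃ q, p = q + 4 := ⟨p - 4, by omega⟩
      simp; ring_nf at hm ⊢; omega, eA, show p - 4 + 1 = p - 3 by omega] at this
    exact this
  have h6 : (p : S) ∣ th^[m + 1] H - A ^ (p ^ 2 + p) * th^[p - 2] H := by
    have := h.th_steps hH (p - 3) p
    rw [show p * (p - 1) + (p - 3 + 1) = m + 1 by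
      obtain ⟨q, rfl⟩ : ∃ q, p = q + 4 := ⟨p - 4, by omega⟩
      simp; ring_nf at hm ⊢; omega, eA, show p - 3 + 1 = p - 2 by omega] at this
    exact this
  rw [show m + 1 + 2 = p ^ 2 by omega] at h3
  obtain ⟨x2, h2⟩ := h2
  obtain ⟨x3, h3⟩ := h3
  obtain ⟨x4, h4⟩ := h4
  obtain ⟨x5, h5⟩ := h5
  obtain ⟨x6, h6⟩ := h6
  obtain ⟨xT, hT⟩ := hT
  set b : S := U + 2 * (th^[p - 3] H * th F) + (k + 1) * (th^[p - 2] H * F) with hb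
  have hfin : (p : S) ^ 2 ∣ A ^ p ^ 2 * (D^[p ^ 2] F - (A ^ (2 * p) * (A * th F) + p * A ^ p * b)) := by
    refine ⟨x2 + x3 + x4 + (xT + 2 * x5 * th F + (k + 1) * x6 * F), ?_⟩
    have e : A ^ p ^ 2 * (D^[p ^ 2] F - (A ^ (2 * p) * (A * th F) + p * A ^ p * b)) =
       A ^ p ^ 2 * D^[p ^ 2] F - A ^ (p ^ 2 + p) * (A ^ (p + 1) * th F + p * b) := by ring
    rw [e, hb]
    linear_combination h2 + h3 + h4 + p * hT + p * 2 * th F * h5 + p * (k + 1) * F * h6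
  have hnd : ¬ (p : S) ∣ A ^ p ^ 2 := fun hd => h.A_ndvd (h.hpp.dvd_of_dvd_pow hd)
  obtain ⟨c, hc⟩ := h.hpp.pow_dvd_of_dvd_mul_left 2 hnd hfin
  exact ⟨A * th F, b, c, by linear_combination hc⟩

end CoreHyp
end Core2

end P4b

section P4c

section Core3
set_option linter.unusedSectionVars false
variable {S T : Type*} [CommRing S] [CommRing T]

lemma mem_pair_pow (a q : S) (n : ℕ) (x : S) (hx : x ∈ Ideal.span {a, q} ^ n) :
    ∃ G : ℕ → S, x = ∑ i ∈ range (n + 1), q ^ (n - i) * a ^ i * G i := by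
  induction n generalizing x with
  | zero => exact ⟨fun _ => x, by simp⟩
  | succ n ih =>
    rw [pow_succ] at hx
    refine Submodule.mul_induction_on hx ?_ ?_
    · intro y hy z hz
      obtain ⟨G, hG⟩ := ih y hy
      obtain ⟨u, v, huv⟩ := Ideal.mem_span_pair.1 hz
      refine ⟨fun i => (if i = 0 then 0 else G (i - 1) * u) + (if i = n + 1 then 0 else G i * v), ?_⟩
      simp only [mul_add, Finset.sum_add_distrib]
      rw [Finset.sum_range_succ', Finset.sum_range_succ (fun i => q ^ (n + 1 - i) * a ^ i * (if i = n + 1 then 0 else G i * v))]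
      simp only [Nat.add_sub_add_right, Nat.add_sub_cancel, if_true, mul_zero, add_zero, Nat.succ_ne_zero, if_false]
      rw [← huv, hG, mul_add, Finset.sum_mul, Finset.sum_mul]
      congr 1
      · exact Finset.sum_congr rfl fun i _ => by ring
      · refine Finset.sum_congr rfl fun i hi => ?_
        have hi' : i < n + 1 := by simpa using hi
        rw [if_neg (by omega), show n + 1 - i = n - i + 1 by omega]
        ring
    · rintro y z ⟨G, rfl⟩ ⟨G', rfl⟩
      exact ⟨fun i => G i + G' i, by simp only [mul_add, Finset.sum_add_distrib]⟩

lemma iter_mul_mod (D : Derivation ℤ S S) {p : ℕ} (hp : p.Prime) (a b : S) :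
    ∃ c, D^[p ^ 2] (a * b) = a * D^[p ^ 2] b + D^[p ^ 2] a * b + p * c ∧
    ∀ (J K : Ideal S), (∀ i, D^[i] a ∈ J) → (∀ i, D^[i] b ∈ K) → c ∈ J * K := by
  have hc : ∀ i ∈ range (p ^ 2 - 1), ∃ e : ℕ, (p ^ 2).choose (i + 1) = p * e := by
    intro i hi
    have hi' : i < p ^ 2 - 1 := by simpa using hi
    exact hp.dvd_choose_pow (by omega) (by omega)
  choose! e he using hc
  have hpos : 0 < p ^ 2 := pow_pos hp.pos 2
  refine ⟨∑ i ∈ range (p ^ 2 - 1), (e i : S) * (D^[i + 1] a * D^[p ^ 2 - (i + 1)] b), ?_, ?_⟩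
  · rw [iter_leibniz, Finset.Nat.sum_antidiagonal_eq_sum_range_succ_mk, Nat.succ_eq_add_one,
      show p ^ 2 + 1 = (p ^ 2 - 1) + 1 + 1 by omega, Finset.sum_range_succ, Finset.sum_range_succ']
    rw [show p ^ 2 - 1 + 1 = p ^ 2 by omega]
    simp only [Nat.choose_zero_right, Nat.choose_self, Nat.sub_self, Nat.sub_zero, Function.iterate_zero, id]
    rw [Finset.mul_sum, Finset.sum_congr rfl (g := fun i => (p : S) * ((e i : S) * (D^[i + 1] a * D^[p ^ 2 - (i + 1)] b)))
      (fun i hi => by rw [he i hi]; push_cast; ring)]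
    simp
    ring
  · intro J K hJ hK
    refine Ideal.sum_mem _ fun i _ => Ideal.mul_mem_left _ _ (Ideal.mul_mem_mul (hJ _) (hK _))

variable [IsDomain S] [Nontrivial T] {p : ℕ} {D E N th : Derivation ℤ S S} {A ε : S} {Ψ : S →+* T}
  {θ : T → T}

namespace CoreHyp
variable (h : CoreHyp p D E N th A ε Ψ θ)
include h

lemma DDA : (p : S) ∣ D (D A) := by
  obtain ⟨H, hH, hε⟩ := h.exists_H
  have e : D (D A) = ((p : S) - 1) * D ε := by
    rw [h.Aε, Derivation.leibniz]; simp
  have h1 : (p : S) ∣ A * D (D A) := by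
    rw [h.th_eq, h.Eε] at hε
    rw [e]
    exact ⟨((p : S) - 1) * (H + ε ^ 2), by linear_combination ((p : S) - 1) * hε⟩
  exact (h.hpp.dvd_or_dvd h1).resolve_left h.A_ndvd

lemma D_iter_A (n : ℕ) (hn : 2 ≤ n) : (p : S) ∣ D^[n] A := by
  obtain ⟨m, rfl⟩ := Nat.exists_eq_add_of_le' hn
  rw [Function.iterate_add_apply]
  exact iter_dvd D m (Derivation.map_natCast D p) h.DDA

lemma D_iter_AD (n j i : ℕ) (hn : j < n) : (p : S) ∣ D^[n] (A ^ j * (D A) ^ i) := by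
  induction n generalizing j i with
  | zero => omega
  | succ n ih =>
    rw [Function.iterate_succ_apply, Derivation.leibniz, Derivation.leibniz_pow, Derivation.leibniz_pow]
    obtain ⟨c, hc⟩ := h.DDA
    rw [iter_add]
    apply dvd_add
    · apply iter_dvd D n (Derivation.map_natCast D p)
      rw [hc]
      exact ⟨A ^ j * (i * (D A ^ (i - 1) * c)), by simp only [smul_eq_mul, nsmul_eq_mul]; ring⟩
    · cases j with
      | zero => simp
      | succ j =>
        have := ih j (i + 1) (by omega)
        rw [show D A ^ i • (j + 1) • A ^ (j + 1 - 1) • D A = ((j + 1 : ℕ) : S) * (A ^ j * D A ^ (i + 1)) by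
          simp only [smul_eq_mul, nsmul_eq_mul, Nat.add_sub_cancel]; ring,
          iter_const D n (Derivation.map_natCast D _)]
        exact this.mul_left _

lemma D_Ap : ∃ c, D (A ^ p) = p * c := 
  ⟨A ^ (p - 1) * D A, by rw [Derivation.leibniz_pow]; simp⟩

lemma D_iter_Ap : (p : S) ^ 2 ∣ D^[p ^ 2] (A ^ p) := by
  have hp := h.hp5
  have h25 : p < p ^ 2 := by nlinarith
  rw [show p ^ 2 = (p ^ 2 - 1) + 1 by omega, Function.iterate_succ_apply, Derivation.leibniz_pow,
    nsmul_eq_mul, iter_const D _ (Derivation.map_natCast D _), sq]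
  apply mul_dvd_mul_left
  have := h.D_iter_AD (p ^ 2 - 1) (p - 1) 1 (by omega)
  simpa using this

lemma memI_p : (p : S) ∈ Ideal.span {A ^ p, (p : S)} := Ideal.subset_span (by simp)
lemma memI_A : A ^ p ∈ Ideal.span {A ^ p, (p : S)} := Ideal.subset_span (by simp)

lemma base_mem {k : ℕ} {F : S} (hF : Mk E N (k + 1) F) :
    D^[p ^ 2] F ∈ Ideal.span {A ^ p, (p : S)} ^ 2 := by
  obtain ⟨a, b, c, e⟩ := h.base hF
  rw [e, sq (Ideal.span _)]
  refine add_mem (add_mem ?_ ?_) ?_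
  · rw [two_mul, pow_add]
    exact Ideal.mul_mem_right _ _ (Ideal.mul_mem_mul h.memI_A h.memI_A)
  · exact Ideal.mul_mem_right _ _ (Ideal.mul_mem_mul h.memI_p h.memI_A)
  · rw [sq]
    exact Ideal.mul_mem_right _ _ (Ideal.mul_mem_mul h.memI_p h.memI_p)

lemma D_memI {n : ℕ} {x : S} (hx : x ∈ Ideal.span {A ^ p, (p : S)} ^ n) :
    D x ∈ Ideal.span {A ^ p, (p : S)} ^ n := by
  induction n generalizing x with
  | zero => simp
  | succ n ih =>
    rw [pow_succ] at hx ⊢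
    refine Submodule.mul_induction_on hx ?_ ?_
    · intro y hy z hz
      have hz' : D z ∈ Ideal.span {A ^ p, (p : S)} := by
        obtain ⟨u, v, rfl⟩ := Ideal.mem_span_pair.1 hz
        obtain ⟨c, hc⟩ := h.D_Ap
        rw [map_add, Derivation.leibniz, Derivation.leibniz, hc]
        simp only [smul_eq_mul, Derivation.map_natCast, mul_zero, zero_add]
        refine add_mem (add_mem ?_ ?_) ?_
        · exact Ideal.mul_mem_left _ _ (Ideal.mul_mem_right _ _ h.memI_p)
        · exact Ideal.mul_mem_right _ _ h.memI_A
        · exact Ideal.mul_mem_right _ _ h.memI_p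
      rw [Derivation.leibniz]
      exact add_mem (Ideal.mul_mem_mul hy hz') (by
        rw [smul_eq_mul, mul_comm z]; exact Ideal.mul_mem_mul (ih hy) hz)
    · intro y z hy hz
      rw [map_add]; exact add_mem hy hz

lemma Di_memI {n : ℕ} {x : S} (hx : x ∈ Ideal.span {A ^ p, (p : S)} ^ n) (i : ℕ) :
    D^[i] x ∈ Ideal.span {A ^ p, (p : S)} ^ n := by
  induction i with
  | zero => exact hx
  | succ i ih => rw [Function.iterate_succ_apply']; exact h.D_memI ih

lemma P_mem {P : S} (hNP : N P = 12) (hEP : E P = 2 * P) :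
    D^[p ^ 2] P ∈ Ideal.span {A ^ p, (p : S)} := by
  have hp5 := h.hp5
  have h25 : 25 ≤ p ^ 2 := by nlinarith
  have hB : Mk E N (p + 1) (A * P - 12 * ε) := by
    have c12 : ∀ K : Derivation ℤ S S, K (12 : S) = 0 := fun K => by
      have := K.map_natCast 12
      simpa using this
    constructor
    · simp only [map_sub, Derivation.leibniz, h.NA, h.Nε, hNP, smul_eq_mul, c12]; ring
    · simp only [map_sub, Derivation.leibniz, h.EA, h.Eε, hEP, smul_eq_mul, c12]; push_cast; ring
  obtain ⟨a, b, c, e⟩ := h.base hB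
  have c12 : D (12 : S) = 0 := by
    have := D.map_natCast 12
    simpa using this
  rw [iter_sub, iter_const D _ c12] at e
  obtain ⟨d, hd, -⟩ := iter_mul_mod D h.hp A P
  obtain ⟨x, hx⟩ := h.D_iter_A (p ^ 2) (by omega)
  obtain ⟨y, hy⟩ := h.D_iter_A (p ^ 2 + 1) (by omega)
  rw [Function.iterate_succ_apply, h.Aε, iter_const D _ (by simp)] at hy
  have key : (p : S) ∣ A * (D^[p ^ 2] P - A ^ p * (A ^ (p - 1) * a)) := by
    refine ⟨A ^ p * b + p * c - x * P - d + 12 * (D^[p ^ 2] ε - y), ?_⟩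
    have e1 : A * (A ^ p * (A ^ (p - 1) * a)) = A ^ (2 * p) * a := by
      rw [two_mul, pow_add, ← mul_pow_sub_one (show p ≠ 0 by omega) A]; ring
    rw [mul_sub, e1]
    rw [hd, hx] at e
    linear_combination e - 12 * hy
  obtain ⟨z, hz⟩ := (h.hpp.dvd_or_dvd key).resolve_left h.A_ndvd
  rw [sub_eq_iff_eq_add.1 hz]
  exact add_mem (Ideal.mul_mem_right _ _ h.memI_p) (Ideal.mul_mem_right _ _ h.memI_A)

lemma step0_mul {x y : S} (hx : D^[p ^ 2] x ∈ Ideal.span {A ^ p, (p : S)})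
    (hy : D^[p ^ 2] y ∈ Ideal.span {A ^ p, (p : S)}) :
    D^[p ^ 2] (x * y) ∈ Ideal.span {A ^ p, (p : S)} := by
  obtain ⟨c, hc, -⟩ := iter_mul_mod D h.hp x y
  rw [hc]
  exact add_mem (add_mem (Ideal.mul_mem_left _ _ hy) (Ideal.mul_mem_right _ _ hx))
    (Ideal.mul_mem_right _ _ h.memI_p)

lemma step1 (h0 : ∀ x, D^[p ^ 2] x ∈ Ideal.span {A ^ p, (p : S)}) {x : S}
    (hx : x ∈ Ideal.span {A ^ p, (p : S)}) :
    D^[p ^ 2] x ∈ Ideal.span {A ^ p, (p : S)} ^ 2 := by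
  obtain ⟨u, v, rfl⟩ := Ideal.mem_span_pair.1 hx
  rw [iter_add, mul_comm v, iter_const D _ (Derivation.map_natCast D p)]
  rw [sq (Ideal.span _)]
  refine add_mem ?_ (Ideal.mul_mem_mul h.memI_p (h0 v))
  obtain ⟨c, hc, hc2⟩ := iter_mul_mod D h.hp u (A ^ p)
  rw [hc]
  refine add_mem (add_mem ?_ (Ideal.mul_mem_mul (h0 u) h.memI_A)) ?_
  · obtain ⟨d, hd⟩ := h.D_iter_Ap
    rw [hd, sq]
    exact Ideal.mul_mem_left _ _ (Ideal.mul_mem_right _ _ (Ideal.mul_mem_mul h.memI_p h.memI_p))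
  · apply Ideal.mul_mem_mul h.memI_p
    have := hc2 ⊤ (Ideal.span {A ^ p, (p : S)} ^ 1) (fun i => trivial)
      (fun i => h.Di_memI (by rw [pow_one]; exact h.memI_A) i)
    rwa [Ideal.top_mul, pow_one] at this

lemma step (h0 : ∀ x, D^[p ^ 2] x ∈ Ideal.span {A ^ p, (p : S)}) (n : ℕ) {x : S}
    (hx : x ∈ Ideal.span {A ^ p, (p : S)} ^ n) :
    D^[p ^ 2] x ∈ Ideal.span {A ^ p, (p : S)} ^ (n + 1) := by
  induction n generalizing x with
  | zero => simpa using h0 x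
  | succ n ih =>
    rw [pow_succ] at hx
    refine Submodule.mul_induction_on hx ?_ ?_
    · intro y hy z hz
      obtain ⟨c, hc, hc2⟩ := iter_mul_mod D h.hp y z
      rw [hc]
      refine add_mem (add_mem ?_ ?_) ?_
      · rw [show n + 1 + 1 = n + 2 by ring, pow_add]
        exact Ideal.mul_mem_mul hy (h.step1 h0 hz)
      · rw [pow_succ]
        exact Ideal.mul_mem_mul (ih hy) hz
      · rw [pow_succ', pow_succ]
        apply Ideal.mul_mem_mul h.memI_p
        have := hc2 _ (Ideal.span {A ^ p, (p : S)} ^ 1) (fun i => h.Di_memI hy i)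
          (fun i => h.Di_memI (by rw [pow_one]; exact hz) i)
        simpa using this
    · intro y z hy hz
      rw [iter_add]; exact add_mem hy hz

theorem main (h0 : ∀ x, D^[p ^ 2] x ∈ Ideal.span {A ^ p, (p : S)}) {k : ℕ} {F : S}
    (hF : Mk E N (k + 1) F) (m : ℕ) :
    D^[(m + 1) * p ^ 2] F ∈ Ideal.span {A ^ p, (p : S)} ^ (m + 2) := by
  induction m with
  | zero => simpa using h.base_mem hF
  | succ m ih =>
    rw [show (m + 1 + 1) * p ^ 2 = p ^ 2 + (m + 1) * p ^ 2 by ring, Function.iterate_add_apply]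
    exact h.step h0 _ ih

end CoreHyp
end Core3

end P4c

section P5a

section ZpSec
variable (p : ℕ) [hpF : Fact p.Prime]

/-- The localization of `ℤ` at `p` as a subring of `ℚ`. -/
def Zp : Subring ℚ where
  carrier := {x | pInt p x}
  mul_mem' := by
    intro a b ha hb h
    rcases (hpF.out.dvd_mul).1 (h.trans (Rat.mul_den_dvd a b)) with h | h
    · exact ha h
    · exact hb h
  one_mem' := by
    intro h
    exact hpF.out.one_lt.ne' (Nat.dvd_one.1 (by simpa using h))
  add_mem' := by
    intro a b ha hb h
    rcases (hpF.out.dvd_mul).1 (h.trans (Rat.add_den_dvd a b)) with h | h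
    · exact ha h
    · exact hb h
  zero_mem' := by
    intro h
    exact hpF.out.one_lt.ne' (Nat.dvd_one.1 (by simpa using h))
  neg_mem' := by
    intro a ha h
    exact ha (by simpa using h)

lemma mem_Zp (x : ℚ) : x ∈ Zp p ↔ pInt p x := Iff.rfl

lemma den_ne {x : ℚ} (hx : x ∈ Zp p) : (x.den : ZMod p) ≠ 0 := by
  rw [Ne, ZMod.natCast_eq_zero_iff]
  exact hx

/-- Reduction modulo `p`. -/
def red : Zp p →+* ZMod p where
  toFun x := ((x : ℚ) : ZMod p)
  map_one' := by simp
  map_zero' := by simp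
  map_add' x y := by
    push_cast
    exact Rat.cast_add_of_ne_zero (den_ne p x.2) (den_ne p y.2)
  map_mul' x y := by
    push_cast
    exact Rat.cast_mul_of_ne_zero (den_ne p x.2) (den_ne p y.2)

lemma red_eq_zero (x : Zp p) (hx : red p x = 0) : ∃ y : Zp p, x = (p : Zp p) * y := by
  have h1 : ((x : ℚ) : ZMod p) = 0 := hx
  rw [Rat.cast_def, div_eq_zero_iff] at h1
  have h2 := h1.resolve_right (den_ne p x.2)
  rw [ZMod.intCast_zmod_eq_zero_iff_dvd] at h2
  obtain ⟨c, hc⟩ := h2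
  have hy : (c : ℚ) / ((x : ℚ).den : ℚ) ∈ Zp p := by
    intro h
    have h3 := Rat.den_dvd c ((x : ℚ).den : ℤ)
    push_cast at h3
    exact x.2 (h.trans (by exact_mod_cast h3))
  refine ⟨⟨_, hy⟩, ?_⟩
  apply Subtype.ext
  push_cast
  conv_lhs => rw [← Rat.num_div_den (x : ℚ), hc]
  push_cast
  ring

lemma inv_mem_Zp (x : Zp p) (hx : red p x ≠ 0) : (x : ℚ)⁻¹ ∈ Zp p := by
  intro h
  rw [Rat.den_inv] at h
  split_ifs at h with h0
  · exact hpF.out.one_lt.ne' (Nat.dvd_one.1 h)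
  · apply hx
    change ((x : ℚ) : ZMod p) = 0
    rw [Rat.cast_def, div_eq_zero_iff]
    left
    rw [ZMod.intCast_zmod_eq_zero_iff_dvd]
    exact Int.natCast_dvd.2 h

lemma prime_p_Zp : Prime (p : Zp p) := by
  refine ⟨?_, ?_, ?_⟩
  · exact_mod_cast hpF.out.ne_zero
  · intro h
    have := (h.map (red p)).ne_zero
    simp at this
  · intro a b ⟨c, hc⟩
    have := congrArg (red p) hc
    simp only [map_mul, map_natCast, CharP.cast_eq_zero, zero_mul, mul_eq_zero] at this
    rcases this with h | h
    · left; obtain ⟨y, hy⟩ := red_eq_zero p a h; exact ⟨y, hy⟩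
    · right; obtain ⟨y, hy⟩ := red_eq_zero p b h; exact ⟨y, hy⟩

/-- The inverse of a natural number prime to `p` (or `0`). -/
def invZ (n : ℕ) : Zp p := if h : red p (n : Zp p) ≠ 0 then ⟨_, inv_mem_Zp p (n : Zp p) h⟩ else 0

lemma invZ_coe {n : ℕ} (hn : ¬ p ∣ n) : ((invZ p n : Zp p) : ℚ) = 1 / (n : ℚ) := by
  have h : red p (n : Zp p) ≠ 0 := by
    rw [map_natCast, Ne, ZMod.natCast_eq_zero_iff]; exact hn
  rw [invZ, dif_pos h]
  simp

lemma mul_invZ {n : ℕ} (hn : ¬ p ∣ n) : (n : Zp p) * invZ p n = 1 := by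
  apply Subtype.ext
  push_cast
  rw [invZ_coe p hn]
  have : (n : ℚ) ≠ 0 := by
    rintro h
    apply hn
    rw [Nat.cast_eq_zero.1 h]; simp
  field_simp

lemma ndvd_of {n : ℕ} (hp5 : 5 ≤ p) (hn : ∀ q, q.Prime → q ∣ n → q < 5) : ¬ p ∣ n := fun h => by
  have := hn p hpF.out h; omega

lemma ndvd12 (hp5 : 5 ≤ p) : ¬ p ∣ 12 := fun h => by
  have h' : p ∣ 2 ^ 2 * 3 := h
  rcases hpF.out.dvd_mul.1 h' with h | h
  · have := Nat.le_of_dvd (by norm_num) (hpF.out.dvd_of_dvd_pow h); omega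
  · have := Nat.le_of_dvd (by norm_num) h; omega
lemma ndvd3 (hp5 : 5 ≤ p) : ¬ p ∣ 3 := fun h => by
  have := Nat.le_of_dvd (by norm_num) h; omega
lemma ndvd2 (hp5 : 5 ≤ p) : ¬ p ∣ 2 := fun h => by
  have := Nat.le_of_dvd (by norm_num) h; omega
lemma ndvdp1 (hp5 : 5 ≤ p) : ¬ p ∣ p - 1 := fun h => by
  have := Nat.le_of_dvd (by omega) h; omega

end ZpSec

section Ring3
variable (p : ℕ) [hpF : Fact p.Prime]

/-- `ℤ_(p)[P,Q,R]`. -/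
abbrev S3 : Type := MvPolynomial (Fin 3) (Zp p)

def DZ : Derivation (Zp p) (S3 p) (S3 p) := mkDerivation (Zp p)
  ![C (invZ p 12) * (X 0 ^ 2 - X 1), C (invZ p 3) * (X 0 * X 1 - X 2), C (invZ p 2) * (X 0 * X 2 - X 1 ^ 2)]
def EZ : Derivation (Zp p) (S3 p) (S3 p) := mkDerivation (Zp p) ![2 * X 0, 4 * X 1, 6 * X 2]
def NZ : Derivation (Zp p) (S3 p) (S3 p) := mkDerivation (Zp p) ![12, 0, 0]

@[simp] lemma DZ0 : DZ p (X 0) = C (invZ p 12) * (X 0 ^ 2 - X 1) := by simp [DZ]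
@[simp] lemma DZ1 : DZ p (X 1) = C (invZ p 3) * (X 0 * X 1 - X 2) := by simp [DZ]
@[simp] lemma DZ2 : DZ p (X 2) = C (invZ p 2) * (X 0 * X 2 - X 1 ^ 2) := by simp [DZ]
@[simp] lemma EZ0 : EZ p (X 0) = 2 * X 0 := by simp [EZ]
@[simp] lemma EZ1 : EZ p (X 1) = 4 * X 1 := by simp [EZ]
@[simp] lemma EZ2 : EZ p (X 2) = 6 * X 2 := by simp [EZ]
@[simp] lemma NZ0 : NZ p (X 0) = 12 := by simp [NZ]
@[simp] lemma NZ1 : NZ p (X 1) = 0 := by simp [NZ]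
@[simp] lemma NZ2 : NZ p (X 2) = 0 := by simp [NZ]

lemma der_nat (d : Derivation (Zp p) (S3 p) (S3 p)) (n : ℕ) : d (n : S3 p) = 0 := by simp
lemma der_C (d : Derivation (Zp p) (S3 p) (S3 p)) (n : Zp p) : d (C n) = 0 := by
  rw [← algebraMap_eq]; exact d.map_algebraMap n

lemma ED_Z (f : S3 p) : EZ p (DZ p f) = DZ p (EZ p f) + 2 * DZ p f := by
  have : ⁅EZ p, DZ p⁆ = DZ p + DZ p := by
    apply MvPolynomial.derivation_ext
    intro i
    rw [Derivation.commutator_apply]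
    have e2 := der_nat p (DZ p) 2
    have e4 := der_nat p (DZ p) 4
    have e6 := der_nat p (DZ p) 6
    push_cast at e2 e4 e6
    fin_cases i <;> simp [Derivation.leibniz, Derivation.leibniz_pow, der_C, e2, e4, e6] <;> ring
  have h := congrArg (fun d => d f) this
  simp only [Derivation.commutator_apply, Derivation.add_apply] at h
  linear_combination h

lemma ND_Z (hp5 : 5 ≤ p) (f : S3 p) : NZ p (DZ p f) = DZ p (NZ p f) + EZ p f := by
  have h12 : (12 : S3 p) * C (invZ p 12) = 1 := by
    have := congrArg (C : Zp p →+* S3 p) (mul_invZ p (ndvd12 p hp5))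
    rw [map_mul, map_natCast, map_one] at this
    exact_mod_cast this
  have h3 : (3 : S3 p) * C (invZ p 3) = 1 := by
    have := congrArg (C : Zp p →+* S3 p) (mul_invZ p (ndvd3 p hp5))
    rw [map_mul, map_natCast, map_one] at this
    exact_mod_cast this
  have h2 : (2 : S3 p) * C (invZ p 2) = 1 := by
    have := congrArg (C : Zp p →+* S3 p) (mul_invZ p (ndvd2 p hp5))
    rw [map_mul, map_natCast, map_one] at this
    exact_mod_cast this
  have : ⁅NZ p, DZ p⁆ = EZ p := by
    apply MvPolynomial.derivation_ext
    intro i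
    rw [Derivation.commutator_apply]
    have e12 := der_nat p (DZ p) 12
    push_cast at e12
    fin_cases i <;> simp [Derivation.leibniz, Derivation.leibniz_pow, der_C, e12]
    · linear_combination (2 * X 0) * h12
    · linear_combination (4 * X 1) * h3
    · linear_combination (6 * X 2) * h2
  have h := congrArg (fun d => d f) this
  simp only [Derivation.commutator_apply] at h
  rw [← h]; ring

lemma EZ_eq (f : S3 p) : EZ p f = 2 * X 0 * pderiv 0 f + 4 * X 1 * pderiv 1 f + 6 * X 2 * pderiv 2 f := by
  induction f using MvPolynomial.induction_on with
  | C a => simp [der_C]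
  | add f g hf hg => simp only [map_add, hf, hg]; ring
  | mul_X f i hf =>
    simp only [Derivation.leibniz, hf, smul_eq_mul]
    fin_cases i <;> simp [pderiv_X] <;> ring

lemma coeff_EZ (f : S3 p) (m : Fin 3 →₀ ℕ) :
    coeff m (EZ p f) = ((2 * m 0 + 4 * m 1 + 6 * m 2 : ℕ) : Zp p) * coeff m f := by
  induction f using MvPolynomial.induction_on' with
  | monomial s a =>
    have : EZ p (monomial s a) = ((2 * s 0 + 4 * s 1 + 6 * s 2 : ℕ) : S3 p) * monomial s a := by
      rw [EZ_eq, mul_assoc, mul_assoc, mul_assoc, X_mul_pderiv_monomial, X_mul_pderiv_monomial,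
        X_mul_pderiv_monomial]
      simp only [nsmul_eq_mul]
      push_cast
      ring
    rw [this, ← map_natCast C, coeff_C_mul, coeff_monomial]
    split_ifs with h
    · rw [h]
    · simp
  | add f g hf hg => rw [map_add, coeff_add, hf, hg, coeff_add]; ring

lemma NZ_eq (f : S3 p) : NZ p f = 12 * pderiv 0 f := by
  have : NZ p = (12 : S3 p) • pderiv 0 := by
    apply MvPolynomial.derivation_ext
    intro i
    fin_cases i <;> simp [pderiv_X]
  rw [this]; rfl

lemma Mk_iff (k : ℕ) (f : S3 p) : (NZ p f = 0 ∧ EZ p f = (k : S3 p) * f) ↔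
    ∀ m ∈ f.support, m 0 = 0 ∧ 2 * m 0 + 4 * m 1 + 6 * m 2 = k := by
  rw [NZ_eq]
  have h12 : (12 : S3 p) ≠ 0 := by exact_mod_cast (by norm_num : (12:ℕ) ≠ 0)
  simp only [mul_eq_zero, h12, false_or]
  constructor
  · rintro ⟨h1, h2⟩ m hm
    rw [mem_support_iff] at hm
    constructor
    · by_contra h0
      have := congrArg (coeff (m - Finsupp.single 0 1)) h1
      rw [coeff_pderiv, tsub_add_cancel_of_le (by simpa [Nat.one_le_iff_ne_zero] using h0)] at this
      simp only [coeff_zero, mul_eq_zero, hm, false_or] at this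
      exact absurd this (Nat.cast_add_one_ne_zero _)
    · have := congrArg (coeff m) h2
      rw [coeff_EZ, ← map_natCast C, coeff_C_mul] at this
      exact_mod_cast mul_right_cancel₀ hm this
  · intro h
    constructor
    · ext m
      rw [coeff_pderiv]
      by_cases hc : coeff (m + Finsupp.single 0 1) f = 0
      · simp [hc]
      · have := (h _ (mem_support_iff.2 hc)).1
        simp at this
    · ext m
      rw [coeff_EZ, ← map_natCast C, coeff_C_mul]
      by_cases hc : coeff m f = 0
      · simp [hc]
      · rw [(h _ (mem_support_iff.2 hc)).2]
end Ring3

end P5a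

section P5b

section Glue
variable (p : ℕ) [hpF : Fact p.Prime]

/-- The inclusion `ℤ_(p)[P,Q,R] → ℚ[P,Q,R]`. -/
def iotaZ : S3 p →+* Poly3 := MvPolynomial.map (Zp p).subtype

lemma iotaZ_inj : Function.Injective (iotaZ p) :=
  MvPolynomial.map_injective _ Subtype.val_injective

lemma coeff_iotaZ (f : S3 p) (m : Fin 3 →₀ ℕ) : coeff m (iotaZ p f) = ((coeff m f : Zp p) : ℚ) := by
  simp [iotaZ, coeff_map]

lemma iotaZ_int (f : S3 p) : polyPInt p (iotaZ p f) := by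
  intro m
  rw [coeff_iotaZ]
  exact (coeff m f).2

lemma exists_iotaZ (f : Poly3) (hf : polyPInt p f) : ∃ g : S3 p, iotaZ p g = f := by
  refine ⟨∑ m ∈ f.support, monomial m ⟨coeff m f, hf m⟩, ?_⟩
  rw [map_sum]
  conv_rhs => rw [f.as_sum]
  refine Finset.sum_congr rfl fun m _ => ?_
  simp [iotaZ, map_monomial]

@[simp] lemma iotaZ_X (i : Fin 3) : iotaZ p (X i) = X i := by simp [iotaZ]
@[simp] lemma iotaZ_C (a : Zp p) : iotaZ p (C a) = C (a : ℚ) := by simp [iotaZ]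

lemma iotaZ_D (hp5 : 5 ≤ p) (f : S3 p) : iotaZ p (DZ p f) = Dop (iotaZ p f) := by
  induction f using MvPolynomial.induction_on with
  | C a => simp [der_C, Dop]
  | add f g hf hg => simp only [map_add, hf, hg, Dop_add]
  | mul_X f i hf =>
    simp only [Derivation.leibniz, smul_eq_mul, map_add, map_mul, hf, Dop_mul, iotaZ_X]
    have : iotaZ p (DZ p (X i)) = Dop (X i) := by
      fin_cases i
      · simp [Dop, pderiv_X, invZ_coe p (ndvd12 p hp5)]
      · simp [Dop, pderiv_X, invZ_coe p (ndvd3 p hp5)]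
      · simp [Dop, pderiv_X, invZ_coe p (ndvd2 p hp5)]
    rw [this]; ring

lemma iotaZ_D_iter (hp5 : 5 ≤ p) (n : ℕ) (f : S3 p) : iotaZ p ((DZ p)^[n] f) = Dop^[n] (iotaZ p f) := by
  induction n with
  | zero => rfl
  | succ n ih => rw [Function.iterate_succ_apply', Function.iterate_succ_apply', iotaZ_D p hp5, ih]

/-- Divisor sums in `ℤ_(p)`. -/
def sigmaR (K : Type*) [CommRing K] (j n : ℕ) : K := ∑ d ∈ n.divisors, (d : K) ^ j
def Es (K : Type*) [CommRing K] (c : K) (j : ℕ) : PowerSeries K :=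
  PowerSeries.mk fun n => if n = 0 then 1 else c * sigmaR K j n

lemma map_Es {K L : Type*} [CommRing K] [CommRing L] (f : K →+* L) (c : K) (j : ℕ) :
    PowerSeries.map f (Es K c j) = Es L (f c) j := by
  ext n
  simp only [Es, PowerSeries.coeff_map, PowerSeries.coeff_mk, sigmaR]
  split_ifs <;> simp

lemma E2s_eq : E2s = Es ℚ (-24) 1 := rfl
lemma E4s_eq : E4s = Es ℚ 240 3 := rfl
lemma E6s_eq : E6s = Es ℚ (-504) 5 := rfl

def PhiR (K : Type*) [CommRing K] : MvPolynomial (Fin 3) K →ₐ[K] PowerSeries K :=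
  aeval ![Es K (-24) 1, Es K 240 3, Es K (-504) 5]

lemma map_PhiR {K L : Type*} [CommRing K] [CommRing L] (f : K →+* L) (x : MvPolynomial (Fin 3) K) :
    PowerSeries.map f (PhiR K x) = PhiR L (MvPolynomial.map f x) := by
  induction x using MvPolynomial.induction_on with
  | C a => simp [PhiR]
  | add f g hf hg => simp only [map_add, hf, hg]
  | mul_X g i hg =>
    simp only [map_mul, hg, map_X]
    congr 1
    fin_cases i <;> simp [PhiR, map_Es, map_ofNat]

lemma PhiR_Q (x : Poly3) : PhiR ℚ x = Phi x := rfl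

/-- Reduced q-expansion. -/
def PsiZ : S3 p →+* PowerSeries (ZMod p) := (PowerSeries.map (red p)).comp (PhiR (Zp p)).toRingHom

lemma PsiZ_eq (x : S3 p) : PsiZ p x = PowerSeries.map (red p) (PhiR (Zp p) x) := rfl

lemma PsiZ_eq' (x : S3 p) : PsiZ p x = PhiR (ZMod p) (MvPolynomial.map (red p) x) := by
  rw [PsiZ_eq, map_PhiR]

lemma mapQ_PhiR (x : S3 p) : PowerSeries.map (Zp p).subtype (PhiR (Zp p) x) = Phi (iotaZ p x) := by
  rw [map_PhiR]; rfl

lemma map_sub_inj : Function.Injective (PowerSeries.map (Zp p).subtype) := by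
  intro a b h
  ext n
  have := congrArg (PowerSeries.coeff n) h
  simpa using this

lemma map_thetaC {K L : Type*} [CommRing K] [CommRing L] (f : K →+* L) (a : PowerSeries K) :
    PowerSeries.map f (thetaC a) = thetaC (PowerSeries.map f a) := by
  ext n; simp [thetaC]

lemma PsiZ_D (hp5 : 5 ≤ p) (x : S3 p) : PsiZ p (DZ p x) = thetaC (PsiZ p x) := by
  rw [PsiZ_eq, PsiZ_eq, ← map_thetaC]
  congr 1
  apply map_sub_inj p
  rw [mapQ_PhiR, iotaZ_D p hp5, Phi_Dop, ← mapQ_PhiR, map_thetaC]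

lemma thetaC_iter {K : Type*} [CommRing K] (n : ℕ) (a : PowerSeries K) (i : ℕ) :
    PowerSeries.coeff i (thetaC^[n] a) = (i : K) ^ n * PowerSeries.coeff i a := by
  induction n with
  | zero => simp
  | succ n ih => rw [Function.iterate_succ_apply', thetaC, PowerSeries.coeff_mk, ih]; ring

lemma thetaC_p (a : PowerSeries (ZMod p)) : thetaC^[p] a = thetaC a := by
  ext i
  rw [thetaC_iter, ZMod.pow_card, thetaC, PowerSeries.coeff_mk]

lemma bern_form (hp5 : 5 ≤ p) : ∃ u : Zp p, 1 / bernoulli (p - 1) = (p : ℚ) * u := by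
  have hodd : Odd p := hpF.out.odd_of_ne_two (by omega)
  obtain ⟨k, hk⟩ := hodd
  have h := Bernoulli.vonStaudt_clausen k
  rw [show 2 * k = p - 1 by omega] at h
  obtain ⟨z, hz⟩ := h
  have hmem : p ∈ (range (p - 1 + 2)).filter (fun q => q.Prime ∧ (q - 1) ∣ p - 1) := by
    simp only [mem_filter, mem_range]
    exact ⟨by omega, hpF.out, dvd_rfl⟩
  rw [← Finset.add_sum_erase _ _ hmem] at hz
  have hs : (∑ q ∈ ((range (p - 1 + 2)).filter (fun q => q.Prime ∧ (q - 1) ∣ p - 1)).erase p, (1 : ℚ) / q) ∈ Zp p := by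
    apply Subring.sum_mem
    intro q hq
    rw [mem_erase, mem_filter] at hq
    have hnd : ¬ p ∣ q := fun h => hq.1 ((Nat.prime_dvd_prime_iff_eq hpF.out hq.2.2.1).1 h).symm
    rw [← invZ_coe p hnd]
    exact (invZ p q).2
  have ht : ∃ t : Zp p, bernoulli (p - 1) = t - 1 / (p : ℚ) := by
    refine ⟨(z : Zp p) - ⟨_, hs⟩, ?_⟩
    push_cast
    rw [hz]; ring
  obtain ⟨t, ht⟩ := ht
  have hpq : (p : ℚ) ≠ 0 := by exact_mod_cast hpF.out.ne_zero
  have hu := inv_mem_Zp p ((p : Zp p) * t - 1) (by simp)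
  refine ⟨⟨_, hu⟩, ?_⟩
  rw [ht]
  push_cast
  rw [show (t : ℚ) - 1 / p = (p * t - 1) / p by field_simp]
  rw [one_div_div, div_eq_mul_inv]

lemma PsiZ_A (hp5 : 5 ≤ p) (A : S3 p) (hA : Phi (iotaZ p A) = EAs p) : PsiZ p A = 1 := by
  obtain ⟨u, hu⟩ := bern_form p hp5
  have h1 : PhiR (Zp p) A = Es (Zp p) (-(2 * ((p : Zp p) - 1) * ((p : Zp p) * u))) (p - 2) := by
    apply map_sub_inj p
    rw [mapQ_PhiR, hA, map_Es]
    ext n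
    simp only [EAs, Es, PowerSeries.coeff_mk]
    split_ifs
    · rfl
    · rw [div_eq_mul_one_div, hu]
      have h2 : (Zp p).subtype 2 = 2 := map_ofNat _ 2
      simp only [map_neg, map_mul, map_sub, map_natCast, map_one, h2]
      rfl
  rw [PsiZ_eq, h1, map_Es]
  ext n
  simp [Es, PowerSeries.coeff_one]

end Glue

end P5b

section P5c

section Inj
variable {K : Type*} [Field K]

lemma aeval_ne_zero (j : PowerSeries K) (hj0 : PowerSeries.constantCoeff j = 1) (hj : j ≠ 1)
    (g : Polynomial K) (h : Polynomial.aeval j g = 0) : g = 0 := by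
  by_contra hg
  obtain ⟨q, hq, hnd⟩ := Polynomial.exists_eq_pow_rootMultiplicity_mul_and_not_dvd g hg 1
  rw [hq, map_mul, map_pow, mul_eq_zero] at h
  rcases h with h | h
  · have := eq_zero_of_pow_eq_zero h
    simp only [map_sub, Polynomial.aeval_X, Polynomial.aeval_C, map_one] at this
    exact hj (sub_eq_zero.1 this)
  · apply hnd
    rw [Polynomial.dvd_iff_isRoot, Polynomial.IsRoot.def]
    have h2 := congrArg PowerSeries.constantCoeff h
    rw [Polynomial.aeval_def, Polynomial.hom_eval₂, hj0, map_zero] at h2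
    have h3 : (PowerSeries.constantCoeff (R := K)).comp (algebraMap K (PowerSeries K)) = RingHom.id K := by
      ext x; simp
    rw [h3] at h2
    exact h2

lemma Es_cc (c : K) (j : ℕ) : PowerSeries.constantCoeff (Es K c j) = 1 := by
  rw [← PowerSeries.coeff_zero_eq_constantCoeff_apply]
  simp [Es]

lemma Es_c1 (c : K) (j : ℕ) : PowerSeries.coeff 1 (Es K c j) = c := by
  simp [Es, sigmaR]

lemma inj_field (h1728 : (1728 : K) ≠ 0) (k : ℕ) (f : MvPolynomial (Fin 3) K)
    (hf : ∀ m ∈ f.support, m 0 = 0 ∧ 2 * m 0 + 4 * m 1 + 6 * m 2 = k) (h0 : PhiR K f = 0) : f = 0 := by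
  set e4 := Es K 240 3 with he4
  set e6 := Es K (-504) 5 with he6
  have c4 : PowerSeries.constantCoeff e4 = 1 := Es_cc _ _
  have c6 : PowerSeries.constantCoeff e6 = 1 := Es_cc _ _
  obtain ⟨v, hv⟩ : ∃ v, e6 * v = 1 := ⟨e6⁻¹, PowerSeries.mul_inv_cancel e6 (by rw [c6]; exact one_ne_zero)⟩
  have cv : PowerSeries.constantCoeff v = 1 := by
    have := congrArg PowerSeries.constantCoeff hv
    simpa [c6] using this
  set j := e4 ^ 3 * v ^ 2 with hj
  have cj : PowerSeries.constantCoeff j = 1 := by simp [hj, c4, cv]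
  have j1 : j ≠ 1 := by
    intro h
    have h2 : e4 ^ 3 = e6 ^ 2 := by
      calc e4 ^ 3 = e4 ^ 3 * (e6 * v) ^ 2 := by rw [hv]; ring
        _ = j * e6 ^ 2 := by rw [hj]; ring
        _ = _ := by rw [h, one_mul]
    have h3 := congrArg (PowerSeries.coeff 1) h2
    rw [PowerSeries.coeff_one_pow, PowerSeries.coeff_one_pow, c4, c6, he4, he6, Es_c1, Es_c1] at h3
    apply h1728
    norm_num at h3
    linear_combination h3
  set g : Polynomial K := ∑ m ∈ f.support, Polynomial.monomial (m 1 + m 2) (coeff m f) with hg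
  have hag : Polynomial.aeval j g = 0 := by
    have : Polynomial.aeval j g = (e4 * v) ^ (k / 2) * PhiR K f := by
      conv_rhs => rw [f.as_sum]
      rw [hg, map_sum, map_sum, Finset.mul_sum]
      refine Finset.sum_congr rfl fun m hm => ?_
      obtain ⟨hm0, hmk⟩ := hf m hm
      rw [Polynomial.aeval_monomial, PhiR, aeval_monomial, Finsupp.prod_fintype _ _ (by simp),
        Fin.prod_univ_three, hm0, show k / 2 = 2 * m 1 + 3 * m 2 by omega]
      simp only [Matrix.cons_val_zero, Matrix.cons_val_one, Matrix.cons_val, pow_zero, one_mul, ← he4, ← he6]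
      have : e6 ^ m 2 * v ^ m 2 = 1 := by rw [← mul_pow, hv, one_pow]
      rw [hj]
      calc _ = algebraMap K (PowerSeries K) (coeff m f) * ((e4 ^ 3 * v ^ 2) ^ (m 1 + m 2)) * 1 := by ring
        _ = _ := by rw [← this]; ring
    rw [this, h0, mul_zero]
  have hg0 := aeval_ne_zero j cj j1 g hag
  by_contra hne
  obtain ⟨m, hm⟩ := MvPolynomial.ne_zero_iff.1 hne
  have hms := mem_support_iff.2 hm
  have h5 := congrArg (fun q => Polynomial.coeff q (m 1 + m 2)) hg0
  simp only [hg, Polynomial.finsetSum_coeff, Polynomial.coeff_monomial, Polynomial.coeff_zero] at h5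
  rw [Finset.sum_eq_single m] at h5
  · simp at h5; exact hm h5
  · intro n hn hnm
    rw [if_neg]
    intro h6
    apply hnm
    have a1 := hf n hn
    have a2 := hf m hms
    ext i
    fin_cases i
    · show n 0 = m 0
      omega
    · show n 1 = m 1
      omega
    · show n 2 = m 2
      omega
  · intro h; exact absurd hms h

end Inj

section DerInt
variable {R S : Type*} [CommRing R] [CommRing S] [Algebra R S]

/-- Forget the scalars of a derivation. -/
def toIntDer (d : Derivation R S S) : Derivation ℤ S S :=
  Derivation.mk' d.toLinearMap.toAddMonoidHom.toIntLinearMap d.leibniz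

def thDer (a b : S) (d e : Derivation ℤ S S) : Derivation ℤ S S := a • d - b • e

lemma thDer_apply (a b : S) (d e : Derivation ℤ S S) (f : S) : thDer a b d e f = a * d f - b * e f := rfl
end DerInt

section Final
variable (p : ℕ) [hpF : Fact p.Prime]

lemma inj_Z (hp5 : 5 ≤ p) (k : ℕ) (f : S3 p) (h1 : NZ p f = 0) (h2 : EZ p f = (k : S3 p) * f)
    (h3 : PsiZ p f = 0) : (p : S3 p) ∣ f := by
  have hs := (Mk_iff p k f).1 ⟨h1, h2⟩
  rw [PsiZ_eq'] at h3
  have h1728 : ((1728 : ℕ) : ZMod p) ≠ 0 := by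
    rw [Ne, ZMod.natCast_eq_zero_iff]
    intro h
    exact ndvd12 p hp5 (hpF.out.dvd_of_dvd_pow (show p ∣ 12 ^ 3 from h))
  have h4 := inj_field (by exact_mod_cast h1728) k _ (fun m hm => hs m (support_map_subset _ _ hm)) h3
  rw [← map_natCast C, C_dvd_iff_dvd_coeff]
  intro m
  have h5 := congrArg (coeff m) h4
  rw [coeff_map, coeff_zero] at h5
  obtain ⟨y, hy⟩ := red_eq_zero p _ h5
  exact ⟨y, hy⟩

lemma core (hp5 : 5 ≤ p) (A : S3 p) (hA : ∀ m ∈ A.support, m 0 = 0 ∧ 2 * m 0 + 4 * m 1 + 6 * m 2 = p - 1)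
    (hAP : Phi (iotaZ p A) = EAs p) :
    CoreHyp p (toIntDer (DZ p)) (toIntDer (EZ p)) (toIntDer (NZ p))
      (thDer A (C (invZ p (p - 1)) * DZ p A) (toIntDer (DZ p)) (toIntDer (EZ p))) A
      (C (invZ p (p - 1)) * DZ p A) (PsiZ p) thetaC where
  hp := hpF.out
  hp5 := hp5
  hpp := by
    rw [← map_natCast C]; exact (MvPolynomial.prime_C_iff _).2 (prime_p_Zp p)
  ED := ED_Z p
  ND := ND_Z p hp5
  NA := ((Mk_iff p (p - 1) A).2 hA).1
  EA := by
    have := ((Mk_iff p (p - 1) A).2 hA).2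
    rw [Nat.cast_sub (by omega), Nat.cast_one] at this
    exact this
  Aε := by
    have := congrArg (C : Zp p →+* S3 p) (mul_invZ p (ndvdp1 p hp5))
    rw [map_mul, map_natCast, map_one, Nat.cast_sub (by omega), Nat.cast_one] at this
    rw [← mul_assoc, this, one_mul]
    rfl
  th_eq := thDer_apply _ _ _ _
  ΨD := PsiZ_D p hp5
  θ0 := by ext; simp [thetaC]
  θ1 := by
    ext n
    by_cases hn : n = 0 <;> simp [thetaC, PowerSeries.coeff_one, hn]
  θp := thetaC_p p
  ΨA := PsiZ_A p hp5 A hAP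
  Ψp := by
    rw [← map_natCast PowerSeries.C]; simp
  inj := inj_Z p hp5

lemma X1_Mk : Mk (toIntDer (EZ p)) (toIntDer (NZ p)) (3 + 1) (X 1) :=
  ⟨NZ1 p, by
    refine (EZ1 p).trans ?_
    norm_num⟩

lemma X2_Mk : Mk (toIntDer (EZ p)) (toIntDer (NZ p)) (5 + 1) (X 2) :=
  ⟨NZ2 p, by
    refine (EZ2 p).trans ?_
    norm_num⟩

lemma h0_Z (hp5 : 5 ≤ p) (A : S3 p)
    (hA : ∀ m ∈ A.support, m 0 = 0 ∧ 2 * m 0 + 4 * m 1 + 6 * m 2 = p - 1)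
    (hAP : Phi (iotaZ p A) = EAs p) (x : S3 p) :
    (toIntDer (DZ p))^[p ^ 2] x ∈ Ideal.span {A ^ p, (p : S3 p)} := by
  have h := core p hp5 A hA hAP
  have hp0 : p ^ 2 = (p ^ 2 - 1) + 1 := by
    have : 0 < p ^ 2 := by positivity
    omega
  induction x using MvPolynomial.induction_on with
  | C a =>
    rw [hp0, Function.iterate_succ_apply]
    have : toIntDer (DZ p) (C a) = 0 := der_C p (DZ p) a
    rw [this, iter_zero]
    exact zero_mem _
  | add f g hf hg =>
    rw [iter_add]; exact add_mem hf hg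
  | mul_X f i hf =>
    refine h.step0_mul hf ?_
    fin_cases i
    · exact h.P_mem (NZ0 p) (EZ0 p)
    · exact Ideal.pow_le_self two_ne_zero (h.base_mem (X1_Mk p))
    · exact Ideal.pow_le_self two_ne_zero (h.base_mem (X2_Mk p))

end Final

end P5c

theorem stmt_18 (p : ℕ) (hp : p.Prime) (hp5 : 5 ≤ p)
    (A : Poly3) (hAiso : Isobaric (p - 1) A) (hAnoP : NoP A)
    (hAint : polyPInt p A) (hAPhi : Phi A = EAs p)
    (k : ℕ) (hk : 0 < k) (F : Poly3) (hFiso : Isobaric k F) (hFnoP : NoP F)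
    (hFint : polyPInt p F)
    (m : ℕ) (hm : 1 ≤ m) :
    InIdealPow p A (m + 1) (Dop^[m * p ^ 2] F) := by
  haveI : Fact p.Prime := ⟨hp⟩
  obtain ⟨a, rfl⟩ := exists_iotaZ p A hAint
  obtain ⟨f, rfl⟩ := exists_iotaZ p F hFint
  have hsup : ∀ (g : S3 p) (m : Fin 3 →₀ ℕ), m ∈ g.support → m ∈ (iotaZ p g).support := by
    intro g m hm
    rw [mem_support_iff] at hm ⊢
    rw [coeff_iotaZ]
    exact fun h => hm (Subtype.ext h)
  have ha : ∀ m ∈ a.support, m 0 = 0 ∧ 2 * m 0 + 4 * m 1 + 6 * m 2 = p - 1 := fun m hm =>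
    ⟨hAnoP m (hsup a m hm), hAiso m (hsup a m hm)⟩
  have hf : ∀ m ∈ f.support, m 0 = 0 ∧ 2 * m 0 + 4 * m 1 + 6 * m 2 = k := fun m hm =>
    ⟨hFnoP m (hsup f m hm), hFiso m (hsup f m hm)⟩
  obtain ⟨k, rfl⟩ : ∃ k', k = k' + 1 := ⟨k - 1, by omega⟩
  obtain ⟨m, rfl⟩ : ∃ m', m = m' + 1 := ⟨m - 1, by omega⟩
  have hmain := (core p hp5 a ha hAPhi).main (h0_Z p hp5 a ha hAPhi) ((Mk_iff p (k + 1) f).2 hf) m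
  obtain ⟨G, hG⟩ := mem_pair_pow _ _ _ _ hmain
  refine ⟨fun i => iotaZ p (G i), fun i => iotaZ_int p _, ?_⟩
  rw [← iotaZ_D_iter p hp5]
  have h2 := congrArg (iotaZ p) hG
  refine h2.trans ?_
  rw [map_sum]
  refine Finset.sum_congr rfl fun i _ => ?_
  simp only [map_mul, map_pow, map_natCast, ← pow_mul]
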